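/- arXiv:1701.09114 — 3 statements merged into one kernel-verified Lean document; each statement's English description precedes it below -/
import Mathlib

section
/- There exists a measurable set S ⊆ ℝ with finite positive Lebesgue measure such that the spectrum Q of the indicator function 1_S (i.e., the closure of the set of ξ ∈ ℝ where the Fourier transform 𝓕(1_S)(ξ) = ∫_ℝ 1_S(t) e^{−2πitξ} dt is nonzero) has density zero: |Q ∩ (−R, R)| / R → 0 as R → ∞, where |·| denotes Lebesgue measure. -/
open MeasureTheory Filter Real Set
open scoped FourierTransform

/-- `u` is the Fourier transform of a continuous compactly supported function vanishing off `K`. -/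
def HasFrequenciesIn (K : Set ℝ) (u : ℝ → ℂ) : Prop :=
  ∃ g : ℝ → ℂ, Continuous g ∧ HasCompactSupport g ∧ Function.support g ⊆ K ∧ u = 𝓕 g

namespace HasFrequenciesIn

variable {K L : Set ℝ} {u v : ℝ → ℂ} {N r s : ℝ}

lemma mono (h : HasFrequenciesIn K u) (hKL : K ⊆ L) : HasFrequenciesIn L u := by
  obtain ⟨g, hg, hc, hs, rfl⟩ := h
  exact ⟨g, hg, hc, hs.trans hKL, rfl⟩

lemma mono_Icc (h : HasFrequenciesIn (Icc (-r) r) u) (hrs : r ≤ s) :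
    HasFrequenciesIn (Icc (-s) s) u :=
  h.mono (Icc_subset_Icc (neg_le_neg hrs) hrs)

lemma add (hu : HasFrequenciesIn K u) (hv : HasFrequenciesIn K v) :
    HasFrequenciesIn K (fun t => u t + v t) := by
  obtain ⟨f, hf, hfc, hfs, rfl⟩ := hu
  obtain ⟨g, hg, hgc, hgs, rfl⟩ := hv
  refine ⟨f + g, hf.add hg, hfc.add hgc,
    (Function.support_add f g).trans (union_subset hfs hgs), ?_⟩
  ext t
  exact (congrFun (VectorFourier.fourierIntegral_add (L := innerₗ ℝ) continuous_fourierChar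
    (by fun_prop) (hf.integrable_of_hasCompactSupport hfc)
    (hg.integrable_of_hasCompactSupport hgc)) t).symm

lemma const_mul (hu : HasFrequenciesIn K u) (c : ℂ) : HasFrequenciesIn K (fun t => c * u t) := by
  obtain ⟨f, hf, hfc, hfs, rfl⟩ := hu
  refine ⟨c • f, hf.const_smul c, hfc.smul_left (f := fun _ => c),
    (Function.support_const_smul_subset c f).trans hfs, ?_⟩
  ext t
  exact (congrFun (VectorFourier.fourierIntegral_const_smul fourierChar volume
    (innerₗ ℝ) f c) t).symm

lemma mul (hu : HasFrequenciesIn (Icc (-r) r) u) (hv : HasFrequenciesIn (Icc (-s) s) v) :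
    HasFrequenciesIn (Icc (-(r + s)) (r + s)) (fun t => u t * v t) := by
  obtain ⟨f, hf, hfc, hfs, rfl⟩ := hu
  obtain ⟨g, hg, hgc, hgs, rfl⟩ := hv
  have hfi : Integrable f := hf.integrable_of_hasCompactSupport hfc
  have hgi : Integrable g := hg.integrable_of_hasCompactSupport hgc
  refine ⟨convolution f g (ContinuousLinearMap.mul ℂ ℂ) volume,
    hfc.continuous_convolution_left _ hf hgi.locallyIntegrable, hfc.convolution _ hgc,
    (support_convolution_subset _).trans ((add_subset_add hfs hgs).trans ?_), ?_⟩
  · rw [neg_add]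
    exact Icc_add_Icc_subset _ _ _ _
  · ext t
    exact (Real.fourier_mul_convolution_eq hfi hgi t).symm

lemma conj (hu : HasFrequenciesIn (Icc (-r) r) u) :
    HasFrequenciesIn (Icc (-r) r) (fun t => starRingEnd ℂ (u t)) := by
  obtain ⟨f, hf, hfc, hfs, rfl⟩ := hu
  refine ⟨fun t => starRingEnd ℂ (f (-t)), Complex.continuous_conj.comp (hf.comp continuous_neg),
    ?_, fun t ht => ?_, ?_⟩
  · exact (hfc.comp_homeomorph (Homeomorph.neg ℝ)).comp_left (map_zero _)
  · have := hfs (show -t ∈ Function.support f by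
      intro h0; exact ht (by simp [h0]))
    exact ⟨by linarith [this.2], by linarith [this.1]⟩
  · ext t
    rw [fourier_real_eq_integral_exp_smul, fourier_real_eq_integral_exp_smul, ← integral_conj,
      ← integral_neg_eq_self]
    congr 1
    ext x
    simp only [smul_eq_mul, map_mul, ← Complex.exp_conj]
    congr 2
    simp [map_ofNat]

lemma comp_add (hu : HasFrequenciesIn (Icc (-r) r) u) (N : ℝ) :
    HasFrequenciesIn (Icc (-r - N) (r - N))
      (fun t => Complex.exp (((2 * π * N * t : ℝ) : ℂ) * Complex.I) * u t) := by
  obtain ⟨f, hf, hfc, hfs, rfl⟩ := hu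
  refine ⟨fun t => f (t + N), by fun_prop, hfc.comp_homeomorph (Homeomorph.addRight N),
    fun t ht => ?_, ?_⟩
  · have := hfs (show t + N ∈ Function.support f from ht)
    exact ⟨by linarith [this.1], by linarith [this.2]⟩
  · have := VectorFourier.fourierIntegral_comp_add_right fourierChar volume (innerₗ ℝ) f N
    ext t
    refine Eq.trans ?_ (congrFun this t).symm
    simp only [Circle.smul_def, Real.fourierChar_apply, smul_eq_mul]
    congr 2
    simp
    ring

/-- Multiplication by a cosine of frequency `N` moves the frequencies near `± N`. -/
lemma mul_cos (hu : HasFrequenciesIn (Icc (-r) r) u) (N : ℝ) :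
    HasFrequenciesIn {ξ | N - r ≤ |ξ| ∧ |ξ| ≤ |N| + r}
      (fun t => u t * ((cos (2 * π * N * t) : ℝ) : ℂ)) := by
  have h : ∀ M : ℝ, |M| = |N| → (N - r ≤ |N| - r) → Icc (-r - M) (r - M) ⊆
      {ξ : ℝ | N - r ≤ |ξ| ∧ |ξ| ≤ |N| + r} := by
    rintro M hM - x ⟨h1, h2⟩
    have h3 : |x + M| ≤ r := abs_le.2 ⟨by linarith, by linarith⟩
    have h4 : |M| ≤ |x| + |x + M| := by
      simpa using abs_sub (x + M) x |>.trans (by rw [add_comm])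
    have h5 : |x| ≤ |x + M| + |M| := by simpa using abs_sub (x + M) M
    have h6 := le_abs_self N
    constructor <;> linarith
  have h0 : N - r ≤ |N| - r := by linarith [le_abs_self N]
  have hp := ((hu.comp_add N).mono (h N rfl h0)).const_mul (1 / 2)
  have hm := ((hu.comp_add (-N)).mono (h (-N) (abs_neg N) h0)).const_mul (1 / 2)
  convert hp.add hm using 2 with t
  rw [Complex.ofReal_cos, Complex.cos]
  push_cast
  ring_nf

lemma integral_eq_zero (hu : HasFrequenciesIn K u) (hi : Integrable u) (h0 : (0 : ℝ) ∉ K) :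
    ∫ t, u t = 0 := by
  obtain ⟨g, hg, hgc, hgs, rfl⟩ := hu
  have h1 := (hg.integrable_of_hasCompactSupport hgc).fourierInv_fourier_eq hi
    (v := 0) hg.continuousAt
  rw [fourierInv_eq'] at h1
  have h2 : g 0 = 0 := by
    by_contra h
    exact h0 (hgs h)
  simpa [h2] using h1

lemma integral_mul_cos_eq_zero (hu : HasFrequenciesIn (Icc (-r) r) u) (hi : Integrable u)
    (hN : r < N) : ∫ t, u t * ((cos (2 * π * N * t) : ℝ) : ℂ) = 0 := by
  refine (hu.mul_cos N).integral_eq_zero (hi.mul_bdd (c := 1) ?_ ?_) ?_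
  · exact Continuous.aestronglyMeasurable (by fun_prop)
  · refine ae_of_all _ fun t => ?_
    rw [Complex.norm_real]
    exact abs_cos_le_one _
  · rintro ⟨h, -⟩
    rw [abs_zero] at h
    linarith

end HasFrequenciesIn

lemma integral_fourier_mul_eq {f g : ℝ → ℂ} (hf : Integrable f) (hg : Integrable g) :
    ∫ t, 𝓕 f t * g t = ∫ t, f t * 𝓕 g t := by
  have h := VectorFourier.integral_fourierIntegral_smul_eq_flip (L := innerₗ ℝ)
    continuous_fourierChar (by fun_prop) hf hg
  rw [flip_innerₗ] at h
  exact h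

lemma HasFrequenciesIn.integral_mul_fourier_eq_zero {K : Set ℝ} {u : ℝ → ℂ}
    (hu : HasFrequenciesIn K u) (hK : ∀ x ∈ K, -x ∈ K) (φ : SchwartzMap ℝ ℂ)
    (hφ : ∀ x ∈ K, φ x = 0) : ∫ t, u t * 𝓕 (φ : ℝ → ℂ) t = 0 := by
  obtain ⟨g, hg, hgc, hgs, rfl⟩ := hu
  have hi : Integrable (𝓕 (φ : ℝ → ℂ)) := by
    rw [← SchwartzMap.fourier_coe]
    exact (𝓕 φ).integrable
  rw [integral_fourier_mul_eq (hg.integrable_of_hasCompactSupport hgc) hi,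
    ← integral_zero ℝ ℂ]
  congr 1
  ext x
  by_cases hx : g x = 0
  · simp [hx]
  · have h1 := congrFun (φ.continuous.fourierInv_fourier_eq φ.integrable hi) (-x)
    rw [fourierInv_eq_fourier_neg, neg_neg] at h1
    rw [h1, hφ _ (hK x (hgs hx)), mul_zero]

/-- The Fourier transform of an integrable function vanishes on an open set as soon as it does so
in the sense of distributions. -/
lemma fourier_eq_zero_of_forall_integral_mul_fourier {f : ℝ → ℂ} (hf : Integrable f) {U : Set ℝ}
    (hU : IsOpen U)
    (h : ∀ φ : SchwartzMap ℝ ℂ, (∀ x ∉ U, φ x = 0) → ∫ t, f t * 𝓕 (φ : ℝ → ℂ) t = 0) :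
    ∀ ξ ∈ U, 𝓕 f ξ = 0 := by
  have hc : Continuous (𝓕 f) := VectorFourier.fourierIntegral_continuous (L := innerₗ ℝ)
    continuous_fourierChar (by fun_prop) hf
  have hae : ∀ᵐ x, x ∈ U → 𝓕 f x = 0 := by
    refine hU.ae_eq_zero_of_integral_contDiff_smul_eq_zero
      (hc.locallyIntegrable.locallyIntegrableOn U) fun g hg hgc hgU => ?_
    have hgc' : HasCompactSupport (fun x => (g x : ℂ)) := hgc.comp_left Complex.ofReal_zero
    let φ : SchwartzMap ℝ ℂ :=
      hgc'.toSchwartzMap (Complex.ofRealCLM.contDiff.comp hg)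
    have hφ : ∀ x, φ x = (g x : ℂ) := fun x => rfl
    have h1 := h φ fun x hx => by
      rw [hφ, image_eq_zero_of_notMem_tsupport (fun hx' => hx (hgU hx')), Complex.ofReal_zero]
    rw [← integral_fourier_mul_eq hf φ.integrable] at h1
    rw [← h1]
    congr 1
    ext x
    rw [hφ, Complex.real_smul, mul_comm]
  have := Measure.eqOn_open_of_ae_eq (μ := volume) (f := 𝓕 f) (g := fun _ => 0)
    ((ae_restrict_iff' hU.measurableSet).2 hae) hU hc.continuousOn continuousOn_const
  exact this

/-- A continuous integrable function with values in `[0, 1]` and frequencies in `[-r, r]`. -/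
structure IsProfile (r : ℝ) (f : ℝ → ℝ) : Prop where
  continuous : Continuous f
  integrable : Integrable f
  mem_Icc : ∀ t, f t ∈ Icc 0 1
  frequencies : HasFrequenciesIn (Icc (-r) r) (fun t => (f t : ℂ))

lemma exists_isProfile : ∃ f : ℝ → ℝ, IsProfile 1 f ∧ f 0 = 1 := by
  let b : ContDiffBump (0 : ℝ) := ⟨1 / 4, 1 / 2, by norm_num, by norm_num⟩
  let g : ℝ → ℂ := fun x => (b.normed volume x : ℂ)
  have hgc : HasCompactSupport g := b.hasCompactSupport_normed.comp_left Complex.ofReal_zero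
  have hgs : ContDiff ℝ (⊤ : ℕ∞) g := Complex.ofRealCLM.contDiff.comp b.contDiff_normed
  have hgi : Integrable g := hgs.continuous.integrable_of_hasCompactSupport hgc
  let φ : SchwartzMap ℝ ℂ := hgc.toSchwartzMap hgs
  have hF : 𝓕 g = 𝓕 φ := (SchwartzMap.fourier_coe φ).symm
  have hcont : Continuous (𝓕 g) := hF ▸ (𝓕 φ).continuous
  have hint : Integrable (fun t => ‖𝓕 g t‖ ^ 2) := by
    rw [hF]
    exact (memLp_two_iff_integrable_sq_norm (𝓕 φ).continuous.aestronglyMeasurable).1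
      ((𝓕 φ).memLp 2)
  have hle : ∀ t, ‖𝓕 g t‖ ≤ 1 := fun t => by
    refine (VectorFourier.norm_fourierIntegral_le_integral_norm fourierChar volume
      (innerₗ ℝ) g t).trans_eq ?_
    rw [← b.integral_normed (μ := volume)]
    congr 1
    ext x
    rw [Complex.norm_real, norm_of_nonneg (b.nonneg_normed x)]
  have hzero : 𝓕 g 0 = 1 := by
    rw [fourier_eq']
    simp only [inner_zero_right, mul_zero, Complex.ofReal_zero, zero_mul, Complex.exp_zero,
      one_smul, g]
    rw [integral_complex_ofReal, b.integral_normed, Complex.ofReal_one]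
  have hfreq : HasFrequenciesIn (Icc (-(1 / 2)) (1 / 2)) (𝓕 g) := by
    refine ⟨g, hgs.continuous, hgc, fun x hx => ?_, rfl⟩
    have h1 : x ∈ Function.support (b.normed volume) := fun h => hx (by simp [g, h])
    rw [b.support_normed_eq, mem_ball_zero_iff, norm_eq_abs] at h1
    exact abs_le.1 h1.le
  refine ⟨fun t => ‖𝓕 g t‖ ^ 2, ⟨hcont.norm.pow 2, hint,
    fun t => ⟨by positivity, pow_le_one₀ (norm_nonneg _) (hle t)⟩, ?_⟩, by simp [hzero]⟩
  have h := hfreq.mul hfreq.conj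
  norm_num only at h
  convert h using 2 with t
  rw [Complex.mul_conj, Complex.normSq_eq_norm_sq]

/-- The distance of `f` from an indicator function is measured by `f * (1 - f)`. -/
def defect (f : ℝ → ℝ) (t : ℝ) : ℝ := f t * (1 - f t)

/-- One step of the construction adds the defect, oscillating at frequency `N`. -/
noncomputable def oscillate (N : ℝ) (f : ℝ → ℝ) (t : ℝ) : ℝ :=
  f t + defect f t * cos (2 * π * N * t)

namespace IsProfile

variable {r s N : ℝ} {f g : ℝ → ℝ}

lemma norm_le_one (hf : IsProfile r f) (t : ℝ) : ‖f t‖ ≤ 1 := by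
  rw [norm_of_nonneg (hf.mem_Icc t).1]
  exact (hf.mem_Icc t).2

lemma memLp_two (hf : IsProfile r f) : MemLp f 2 := by
  rw [memLp_two_iff_integrable_sq hf.continuous.aestronglyMeasurable]
  refine hf.integrable.mono' (hf.continuous.pow 2).aestronglyMeasurable (ae_of_all _ fun t => ?_)
  rw [norm_of_nonneg (sq_nonneg _)]
  nlinarith [(hf.mem_Icc t).1, (hf.mem_Icc t).2]

lemma integrable_mul (hf : IsProfile r f) {u : ℝ → ℝ} (hu : Continuous u)
    (hb : ∀ t, ‖u t‖ ≤ 1) : Integrable (fun t => f t * u t) :=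
  hf.integrable.mul_bdd hu.aestronglyMeasurable (ae_of_all _ hb)

lemma continuous_defect (hf : IsProfile r f) : Continuous (defect f) :=
  hf.continuous.mul (continuous_const.sub hf.continuous)

lemma defect_nonneg (hf : IsProfile r f) (t : ℝ) : 0 ≤ defect f t :=
  mul_nonneg (hf.mem_Icc t).1 (sub_nonneg.2 (hf.mem_Icc t).2)

lemma defect_le (hf : IsProfile r f) (t : ℝ) : defect f t ≤ f t :=
  mul_le_of_le_one_right (hf.mem_Icc t).1 (by linarith [(hf.mem_Icc t).1])

lemma frequencies_defect (hf : IsProfile r f) (hr : 0 ≤ r) :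
    HasFrequenciesIn (Icc (-(2 * r)) (2 * r)) (fun t => (defect f t : ℂ)) := by
  have h := (hf.frequencies.mono_Icc (by linarith : r ≤ 2 * r)).add
    (((hf.frequencies.mul hf.frequencies).mono_Icc (by linarith : r + r ≤ 2 * r)).const_mul (-1))
  convert h using 2 with t
  simp only [defect]
  push_cast
  ring

lemma isProfile_defect (hf : IsProfile r f) (hr : 0 ≤ r) : IsProfile (2 * r) (defect f) where
  continuous := hf.continuous_defect
  integrable := hf.integrable.mono' hf.continuous_defect.aestronglyMeasurable
    (ae_of_all _ fun t => by rw [norm_of_nonneg (hf.defect_nonneg t)]; exact hf.defect_le t)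
  mem_Icc t := ⟨hf.defect_nonneg t, (hf.defect_le t).trans (hf.mem_Icc t).2⟩
  frequencies := hf.frequencies_defect hr

lemma mul (hf : IsProfile r f) (hg : IsProfile s g) : IsProfile (r + s) (fun t => f t * g t) where
  continuous := hf.continuous.mul hg.continuous
  integrable := hf.integrable_mul hg.continuous hg.norm_le_one
  mem_Icc t := ⟨mul_nonneg (hf.mem_Icc t).1 (hg.mem_Icc t).1,
    mul_le_one₀ (hf.mem_Icc t).2 (hg.mem_Icc t).1 (hg.mem_Icc t).2⟩
  frequencies := by simpa using hf.frequencies.mul hg.frequencies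

lemma integral_mul_cos_eq_zero (hf : IsProfile r f) (hN : r < N) :
    ∫ t, f t * cos (2 * π * N * t) = 0 := by
  have h := hf.frequencies.integral_mul_cos_eq_zero hf.integrable.ofReal hN
  simp only [← Complex.ofReal_mul] at h
  rw [integral_complex_ofReal] at h
  exact_mod_cast h

lemma frequencies_defect_mul_cos (hf : IsProfile r f) (hr : 0 ≤ r) (hN : 0 ≤ N) :
    HasFrequenciesIn {ξ | N - 2 * r ≤ |ξ| ∧ |ξ| ≤ N + 2 * r}
      (fun t => ((defect f t * cos (2 * π * N * t) : ℝ) : ℂ)) := by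
  have h := (hf.frequencies_defect hr).mul_cos N
  rw [abs_of_nonneg hN] at h
  simpa only [Complex.ofReal_mul] using h

lemma integrable_defect_mul_cos (hf : IsProfile r f) (hr : 0 ≤ r) (N : ℝ) :
    Integrable (fun t => defect f t * cos (2 * π * N * t)) :=
  (hf.isProfile_defect hr).integrable_mul (by fun_prop) fun _ => abs_cos_le_one _

lemma isProfile_oscillate (hf : IsProfile r f) (hr : 0 ≤ r) (hN : 0 ≤ N) :
    IsProfile (N + 2 * r) (oscillate N f) where
  continuous := hf.continuous.add (hf.continuous_defect.mul (by fun_prop))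
  integrable := hf.integrable.add (hf.integrable_defect_mul_cos hr N)
  mem_Icc t := by
    have h1 := neg_one_le_cos (2 * π * N * t)
    have h2 := cos_le_one (2 * π * N * t)
    have h3 := hf.defect_nonneg t
    unfold oscillate
    unfold defect at h3 ⊢
    constructor <;> nlinarith [sq_nonneg (f t), sq_nonneg (1 - f t)]
  frequencies := by
    have h := (hf.frequencies.mono_Icc (by linarith : r ≤ N + 2 * r)).add
      ((hf.frequencies_defect_mul_cos hr hN).mono fun ξ hξ => abs_le.1 hξ.2)
    simpa only [oscillate, Complex.ofReal_add] using h

lemma integral_oscillate (hf : IsProfile r f) (hr : 0 ≤ r) (hN : 2 * r < N) :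
    ∫ t, oscillate N f t = ∫ t, f t := by
  unfold oscillate
  rw [integral_add hf.integrable (hf.integrable_defect_mul_cos hr N),
    (hf.isProfile_defect hr).integral_mul_cos_eq_zero hN, add_zero]

/-- The increments of the construction are orthogonal to functions of low frequency. -/
lemma integral_mul_oscillate_sub (hg : IsProfile s g) (hf : IsProfile r f) (hr : 0 ≤ r)
    (hN : s + 2 * r < N) : ∫ t, g t * (oscillate N f t - f t) = 0 := by
  rw [← (hg.mul (hf.isProfile_defect hr)).integral_mul_cos_eq_zero hN]
  congr 1
  ext t
  rw [oscillate]
  ring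

/-- The size of an increment is comparable with the defect. -/
lemma integral_defect_sq (hf : IsProfile r f) (hr : 0 ≤ r) (hN : 2 * r < N) :
    ∫ t, defect f t ^ 2 = 2 * ∫ t, (oscillate N f t - f t) ^ 2 := by
  have hd := (hf.isProfile_defect hr).mul (hf.isProfile_defect hr)
  have h0 := hd.integral_mul_cos_eq_zero (N := 2 * N) (by linarith)
  have hi := hd.integrable_mul (u := fun t => cos (2 * π * (2 * N) * t)) (by fun_prop)
    fun _ => abs_cos_le_one _
  have h1 : ∫ t, 2 * (oscillate N f t - f t) ^ 2 = ∫ t, (defect f t * defect f t +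
      defect f t * defect f t * cos (2 * π * (2 * N) * t)) := by
    congr 1
    ext t
    rw [oscillate, show 2 * π * (2 * N) * t = 2 * (2 * π * N * t) by ring, cos_two_mul]
    ring
  rw [← integral_const_mul, h1, integral_add hd.integrable hi, h0, add_zero]
  simp only [sq]

end IsProfile

/-- The bandwidth of the `n`-th approximation. -/
noncomputable def bandwidth : ℕ → ℝ
  | 0 => 1
  | n + 1 => (n + 7) * bandwidth n

/-- The oscillation frequency used to build the `(n + 1)`-st approximation. -/
noncomputable def oscFrequency (n : ℕ) : ℝ := (n + 5) * bandwidth n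

/-- Successive approximations of the indicator function. -/
noncomputable def approx (f : ℝ → ℝ) : ℕ → ℝ → ℝ
  | 0 => f
  | n + 1 => oscillate (oscFrequency n) (approx f n)

lemma bandwidth_pos (n : ℕ) : 0 < bandwidth n := by
  induction n with
  | zero => exact one_pos
  | succ n ih => rw [bandwidth]; positivity

lemma oscFrequency_pos (n : ℕ) : 0 < oscFrequency n := by
  have := bandwidth_pos n
  rw [oscFrequency]
  positivity

lemma monotone_bandwidth : Monotone bandwidth := by
  refine monotone_nat_of_le_succ fun n => ?_
  rw [bandwidth]
  have h1 := bandwidth_pos n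
  have h2 : (0 : ℝ) ≤ n := n.cast_nonneg
  nlinarith

lemma le_bandwidth (n : ℕ) : (n : ℝ) ≤ bandwidth n := by
  induction n with
  | zero => simp [bandwidth]
  | succ n ih =>
    rw [bandwidth]
    have h1 : 1 ≤ bandwidth n := monotone_bandwidth n.zero_le
    have h2 : (0 : ℝ) ≤ n := n.cast_nonneg
    push_cast
    nlinarith

lemma isProfile_approx {f : ℝ → ℝ} (hf : IsProfile 1 f) (n : ℕ) :
    IsProfile (bandwidth n) (approx f n) := by
  induction n with
  | zero => exact hf
  | succ n ih =>
    have h := ih.isProfile_oscillate (bandwidth_pos n).le (oscFrequency_pos n).le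
    rwa [show oscFrequency n + 2 * bandwidth n = bandwidth (n + 1) by
      rw [oscFrequency, bandwidth]; ring] at h

lemma frequencies_approx {f : ℝ → ℝ} (hf : IsProfile 1 f) {n m : ℕ} (hnm : n ≤ m) :
    HasFrequenciesIn {ξ | |ξ| ≤ bandwidth n ∨ (n + 3) * bandwidth n ≤ |ξ|}
      (fun t => (approx f m t : ℂ)) := by
  induction m, hnm using Nat.le_induction with
  | base => exact (isProfile_approx hf n).frequencies.mono fun ξ hξ => Or.inl (abs_le.2 hξ)
  | succ m hnm ih =>
    have h := ih.add (((isProfile_approx hf m).frequencies_defect_mul_cos (bandwidth_pos m).le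
      (oscFrequency_pos m).le).mono fun ξ hξ => Or.inr ?_)
    · simpa only [approx, oscillate, Complex.ofReal_add] using h
    · have h1 : (n : ℝ) ≤ m := by exact_mod_cast hnm
      have h2 := monotone_bandwidth hnm
      have h3 := (bandwidth_pos n).le
      refine le_trans ?_ hξ.1
      rw [oscFrequency, ← sub_mul]
      have h4 : (n + 3 : ℝ) ≤ m + 5 - 2 := by linarith
      have h5 : (0 : ℝ) ≤ m + 5 - 2 := by linarith [n.cast_nonneg (α := ℝ)]
      gcongr

lemma inner_toLp_toLp {u v : ℝ → ℝ} (hu : MemLp u 2) (hv : MemLp v 2) :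
    inner ℝ (hu.toLp u) (hv.toLp v) = ∫ t, u t * v t := by
  rw [L2.inner_def]
  refine integral_congr_ae ?_
  filter_upwards [hu.coeFn_toLp, hv.coeFn_toLp] with t h1 h2
  rw [h1, h2]
  exact mul_comm _ _

lemma norm_toLp_sq {u : ℝ → ℝ} (hu : MemLp u 2) : ‖hu.toLp u‖ ^ 2 = ∫ t, u t ^ 2 := by
  rw [← real_inner_self_eq_norm_sq, inner_toLp_toLp]
  simp only [sq]

section Hilbert

variable {H : Type*} [NormedAddCommGroup H] [InnerProductSpace ℝ H] {F : ℕ → H}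

lemma norm_sq_eq_of_orthogonal_increments
    (horth : ∀ n m, n ≤ m → inner ℝ (F n) (F (m + 1) - F m) = 0) {n m : ℕ} (hnm : n ≤ m) :
    ‖F m‖ ^ 2 = ‖F n‖ ^ 2 + ‖F m - F n‖ ^ 2 := by
  have h : inner ℝ (F n) (F m - F n) = 0 := by
    induction m, hnm using Nat.le_induction with
    | base => simp
    | succ m hnm ih =>
      rw [← sub_add_sub_cancel (F (m + 1)) (F m), inner_add_right, horth n m hnm, ih, add_zero]
  have h2 := norm_add_sq_eq_norm_sq_add_norm_sq_of_inner_eq_zero _ _ h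
  rw [add_sub_cancel] at h2
  simpa only [sq] using h2

lemma monotone_norm_of_orthogonal_increments
    (horth : ∀ n m, n ≤ m → inner ℝ (F n) (F (m + 1) - F m) = 0) : Monotone fun n => ‖F n‖ := by
  intro n m hnm
  have h := norm_sq_eq_of_orthogonal_increments horth hnm
  exact le_of_sq_le_sq (by nlinarith [sq_nonneg ‖F m - F n‖]) (norm_nonneg _)

lemma cauchySeq_of_orthogonal_increments
    (horth : ∀ n m, n ≤ m → inner ℝ (F n) (F (m + 1) - F m) = 0) {C : ℝ}
    (hC : ∀ n, ‖F n‖ ^ 2 ≤ C) : CauchySeq F := by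
  have hmono : Monotone fun n => ‖F n‖ ^ 2 := fun n m hnm =>
    pow_le_pow_left₀ (norm_nonneg _) (monotone_norm_of_orthogonal_increments horth hnm) 2
  have hlim := (tendsto_atTop_ciSup hmono ⟨C, by rintro _ ⟨n, rfl⟩; exact hC n⟩).cauchySeq
  rw [Metric.cauchySeq_iff'] at hlim ⊢
  intro ε hε
  obtain ⟨n, hn⟩ := hlim (ε ^ 2) (by positivity)
  refine ⟨n, fun m hm => ?_⟩
  have h1 := hn m hm
  rw [Real.dist_eq, norm_sq_eq_of_orthogonal_increments horth hm, add_sub_cancel_left,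
    abs_of_nonneg (sq_nonneg _)] at h1
  rw [dist_eq_norm]
  exact lt_of_pow_lt_pow_left₀ 2 hε.le h1

end Hilbert

section Limit

variable {f : ℝ → ℝ}

/-- The approximations as elements of `L²`. -/
noncomputable def approxLp (hf : IsProfile 1 f) (n : ℕ) : Lp ℝ 2 (volume : Measure ℝ) :=
  (isProfile_approx hf n).memLp_two.toLp (approx f n)

lemma approxLp_succ_sub (hf : IsProfile 1 f) (n : ℕ) :
    approxLp hf (n + 1) - approxLp hf n =
      ((isProfile_approx hf (n + 1)).memLp_two.sub (isProfile_approx hf n).memLp_two).toLp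
        (approx f (n + 1) - approx f n) :=
  (MemLp.toLp_sub _ _).symm

lemma three_mul_bandwidth_lt (n : ℕ) : bandwidth n + 2 * bandwidth n < oscFrequency n := by
  have h1 := bandwidth_pos n
  have h2 : (0 : ℝ) ≤ n := n.cast_nonneg
  rw [oscFrequency]
  nlinarith

lemma two_mul_bandwidth_lt (n : ℕ) : 2 * bandwidth n < oscFrequency n := by
  linarith [three_mul_bandwidth_lt n, bandwidth_pos n]

lemma orthogonal_approxLp (hf : IsProfile 1 f) (n m : ℕ) (hnm : n ≤ m) :
    inner ℝ (approxLp hf n) (approxLp hf (m + 1) - approxLp hf m) = 0 := by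
  rw [approxLp_succ_sub, approxLp, inner_toLp_toLp]
  refine (isProfile_approx hf n).integral_mul_oscillate_sub (isProfile_approx hf m)
    (bandwidth_pos m).le (lt_of_le_of_lt ?_ (three_mul_bandwidth_lt m))
  gcongr
  exact monotone_bandwidth hnm

lemma integral_approx (hf : IsProfile 1 f) (n : ℕ) : ∫ t, approx f n t = ∫ t, f t := by
  induction n with
  | zero => rfl
  | succ n ih =>
    rw [← ih]
    exact (isProfile_approx hf n).integral_oscillate (bandwidth_pos n).le (two_mul_bandwidth_lt n)

lemma norm_approxLp_sq_le (hf : IsProfile 1 f) (n : ℕ) : ‖approxLp hf n‖ ^ 2 ≤ ∫ t, f t := by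
  have h := isProfile_approx hf n
  rw [approxLp, norm_toLp_sq, ← integral_approx hf n]
  refine integral_mono h.memLp_two.integrable_sq h.integrable fun t => ?_
  have ht := h.mem_Icc t
  change approx f n t ^ 2 ≤ approx f n t
  nlinarith [ht.1, ht.2]

lemma exists_tendsto_approxLp (hf : IsProfile 1 f) :
    ∃ g, Tendsto (approxLp hf) atTop (nhds g) :=
  cauchySeq_tendsto_of_complete
    (cauchySeq_of_orthogonal_increments (orthogonal_approxLp hf) (norm_approxLp_sq_le hf))

lemma isProfile_defect_approx (hf : IsProfile 1 f) (n : ℕ) :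
    IsProfile (2 * bandwidth n) (defect (approx f n)) :=
  (isProfile_approx hf n).isProfile_defect (bandwidth_pos n).le

lemma tendsto_defectLp (hf : IsProfile 1 f) :
    Tendsto (fun n => (isProfile_defect_approx hf n).memLp_two.toLp (defect (approx f n))) atTop
      (nhds 0) := by
  obtain ⟨g, hg⟩ := exists_tendsto_approxLp hf
  have h1 : Tendsto (fun n => 2 * ‖approxLp hf (n + 1) - approxLp hf n‖ ^ 2) atTop (nhds 0) := by
    simpa using ((((tendsto_add_atTop_iff_nat 1).2 hg).sub hg).norm.pow 2).const_mul 2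
  rw [tendsto_zero_iff_norm_tendsto_zero]
  convert h1.sqrt using 2 with n
  · rw [approxLp_succ_sub, norm_toLp_sq]
    have h2 := (isProfile_approx hf n).integral_defect_sq (bandwidth_pos n).le
      (two_mul_bandwidth_lt n)
    rw [← norm_toLp_sq (isProfile_defect_approx hf n).memLp_two] at h2
    rw [← sqrt_sq (norm_nonneg _), h2]
    rfl
  · exact sqrt_zero.symm

/-- The approximations converge in `L²` to an indicator function. -/
lemma exists_tendsto_approxLp_indicator (hf : IsProfile 1 f) : ∃ (S : Set ℝ) (g : Lp ℝ 2 volume),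
    MeasurableSet S ∧ Tendsto (approxLp hf) atTop (nhds g) ∧
      g =ᵐ[volume] S.indicator fun _ => 1 := by
  obtain ⟨g, hg⟩ := exists_tendsto_approxLp hf
  obtain ⟨ns, hns, hdef⟩ :=
    (tendstoInMeasure_of_tendsto_Lp (tendsto_defectLp hf)).exists_seq_tendsto_ae
  obtain ⟨ms, hms, hlim⟩ :=
    (tendstoInMeasure_of_tendsto_Lp (hg.comp hns.tendsto_atTop)).exists_seq_tendsto_ae
  refine ⟨{t | g t = 1}, g,
    (Lp.stronglyMeasurable g).measurable (measurableSet_singleton 1), hg, ?_⟩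
  have hA : ∀ᵐ t : ℝ, ∀ n, approxLp hf n t = approx f n t :=
    ae_all_iff.2 fun n => MemLp.coeFn_toLp _
  have hD : ∀ᵐ t : ℝ, ∀ n, (isProfile_defect_approx hf n).memLp_two.toLp (defect (approx f n)) t =
      defect (approx f n) t := ae_all_iff.2 fun n => MemLp.coeFn_toLp _
  filter_upwards [hdef, hlim, hA, hD, Lp.coeFn_zero ℝ 2 (volume : Measure ℝ)]
    with t h1 h2 h3 h4 h5
  simp only [h4, h5, Function.comp_apply, h3, Pi.zero_apply] at h1 h2
  have h6 : Tendsto (fun i => defect (approx f (ns (ms i))) t) atTop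
      (nhds (g t * (1 - g t))) := h2.mul (h2.const_sub 1)
  have h7 := tendsto_nhds_unique h6 (h1.comp hms.tendsto_atTop)
  by_cases h : g t = 1
  · simp [indicator, h]
  · have h8 : g t = 0 := (mul_eq_zero.1 h7).resolve_right (sub_ne_zero.2 (Ne.symm h))
    simp [indicator, h8]

lemma tendsto_integral_mul_of_tendsto_Lp {F : ℕ → Lp ℝ 2 (volume : Measure ℝ)}
    {g : Lp ℝ 2 (volume : Measure ℝ)} (hF : Tendsto F atTop (nhds g)) {ψ : ℝ → ℂ}
    (hψ : MemLp ψ 2) :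
    Tendsto (fun n => ∫ t, (F n t : ℂ) * ψ t) atTop (nhds (∫ t, (g t : ℂ) * ψ t)) := by
  have hi : ∀ G : Lp ℝ 2 (volume : Measure ℝ), Integrable (fun t => (G t : ℂ) * ψ t) :=
    fun G => (Lp.memLp G).ofReal.integrable_mul hψ
  have hbound : ∀ n, ‖(∫ t, (F n t : ℂ) * ψ t) - ∫ t, (g t : ℂ) * ψ t‖ ≤
      ‖F n - g‖ * ‖hψ.toLp ψ‖ := fun n => by
    have hu : MemLp (F n - g : ℝ → ℝ) 2 := (Lp.memLp _).sub (Lp.memLp _)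
    have h1 : ‖F n - g‖ = ‖hu.norm.toLp _‖ := by
      rw [Lp.norm_toLp, Lp.norm_def, eLpNorm_norm, eLpNorm_congr_ae (Lp.coeFn_sub _ _)]
    have h2 : ‖hψ.toLp ψ‖ = ‖hψ.norm.toLp _‖ := by
      rw [Lp.norm_toLp, Lp.norm_toLp, eLpNorm_norm]
    rw [← integral_sub (hi _) (hi _), h1, h2]
    refine le_trans ?_ (real_inner_le_norm _ _)
    rw [inner_toLp_toLp]
    refine (norm_integral_le_integral_norm _).trans_eq ?_
    congr 1
    ext t
    rw [← sub_mul, norm_mul, ← Complex.ofReal_sub, Complex.norm_real]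
    rfl
  rw [tendsto_iff_norm_sub_tendsto_zero]
  refine squeeze_zero (fun _ => norm_nonneg _) hbound ?_
  simpa using (tendsto_iff_norm_sub_tendsto_zero.1 hF).mul_const ‖hψ.toLp ψ‖

end Limit

lemma exists_mem_Ico_of_tendsto_atTop {a : ℕ → ℝ} (ha : Tendsto a atTop atTop) {n₀ : ℕ} {x : ℝ}
    (hx : a n₀ ≤ x) : ∃ n, n₀ ≤ n ∧ a n ≤ x ∧ x < a (n + 1) := by
  by_contra! h
  have hle : ∀ n, n₀ ≤ n → a n ≤ x := fun n hn => by
    induction n, hn using Nat.le_induction with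
    | base => exact hx
    | succ n hn ih => exact h n hn ih
  obtain ⟨n, hn, hn'⟩ := ((eventually_ge_atTop n₀).and (ha.eventually_gt_atTop x)).exists
  exact absurd (hle n hn) (not_le.2 hn')

lemma volume_inter_Ioo_le {Q : Set ℝ}
    (hQ : ∀ n : ℕ, Q ⊆ {ξ | |ξ| ≤ bandwidth n ∨ (n + 3) * bandwidth n ≤ |ξ|}) {n : ℕ} {x : ℝ}
    (hx : x < (n + 4) * bandwidth (n + 1)) :
    (volume (Q ∩ Ioo (-x) x)).toReal ≤ 10 * bandwidth n := by
  have hsub : Q ∩ Ioo (-x) x ⊆ Icc (-bandwidth n) (bandwidth n) ∪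
      (Icc ((n + 3) * bandwidth n) ((n + 7) * bandwidth n) ∪
        Icc (-((n + 7) * bandwidth n)) (-((n + 3) * bandwidth n))) := by
    rintro ξ ⟨hξ, hξx⟩
    rcases hQ n hξ with h1 | h1
    · exact Or.inl (abs_le.1 h1)
    · have h2 : |ξ| ≤ (n + 7) * bandwidth n := by
        rcases hQ (n + 1) hξ with h2 | h2
        · exact h2
        · have h3 := abs_lt.2 hξx
          push_cast at h2
          linarith
      rcases le_total 0 ξ with h | h
      · rw [abs_of_nonneg h] at h1 h2
        exact Or.inr (Or.inl ⟨h1, h2⟩)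
      · rw [abs_of_nonpos h] at h1 h2
        exact Or.inr (Or.inr ⟨by linarith, by linarith⟩)
  have hb := (bandwidth_pos n).le
  refine ENNReal.toReal_le_of_le_ofReal (by positivity) ((measure_mono hsub).trans ?_)
  refine (measure_union_le _ _).trans ((add_le_add_right (measure_union_le _ _) _).trans_eq ?_)
  rw [volume_Icc, volume_Icc, volume_Icc, ← ENNReal.ofReal_add, ← ENNReal.ofReal_add]
  · congr 1
    ring
  all_goals nlinarith

lemma tendsto_volume_inter_Ioo_div {Q : Set ℝ}
    (hQ : ∀ n : ℕ, Q ⊆ {ξ | |ξ| ≤ bandwidth n ∨ (n + 3) * bandwidth n ≤ |ξ|}) :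
    Tendsto (fun x : ℝ => (volume (Q ∩ Ioo (-x) x)).toReal / x) atTop (nhds 0) := by
  have ha : Tendsto (fun n : ℕ => ((n : ℝ) + 3) * bandwidth n) atTop atTop := by
    refine tendsto_atTop_mono (fun n => ?_) tendsto_natCast_atTop_atTop
    have h1 := le_bandwidth n
    have h2 : (0 : ℝ) ≤ n := n.cast_nonneg
    nlinarith
  rw [Metric.tendsto_atTop]
  intro ε hε
  obtain ⟨n₀, hn₀⟩ := exists_nat_gt (10 / ε)
  refine ⟨(n₀ + 3) * bandwidth n₀, fun x hx => ?_⟩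
  obtain ⟨n, hn, h1, h2⟩ := exists_mem_Ico_of_tendsto_atTop ha hx
  have hb := bandwidth_pos n
  have hx0 : 0 < x := lt_of_lt_of_le (by positivity) h1
  have h3 := volume_inter_Ioo_le hQ (n := n) (x := x) (by
    push_cast at h2
    linarith)
  rw [Real.dist_eq, sub_zero, abs_of_nonneg (by positivity), div_lt_iff₀ hx0]
  have hn' : (n₀ : ℝ) ≤ n := by exact_mod_cast hn
  rw [div_lt_iff₀ hε] at hn₀
  calc (volume (Q ∩ Ioo (-x) x)).toReal ≤ 10 * bandwidth n := h3
    _ < ((n + 3) * ε) * bandwidth n := by gcongr; nlinarith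
    _ = ε * ((n + 3) * bandwidth n) := by ring
    _ ≤ ε * x := by gcongr

/-- Spectral information passes from the approximations to their `L²` limit. -/
lemma closure_spectrum_subset {f : ℝ → ℝ} (hf : IsProfile 1 f) {g : Lp ℝ 2 (volume : Measure ℝ)}
    (hg : Tendsto (approxLp hf) atTop (nhds g)) {F : ℝ → ℂ} (hF : Integrable F)
    (hFg : F =ᵐ[volume] fun t => (g t : ℂ)) (n : ℕ) :
    closure {ξ | 𝓕 F ξ ≠ 0} ⊆ {ξ | |ξ| ≤ bandwidth n ∨ (n + 3) * bandwidth n ≤ |ξ|} := by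
  set K : Set ℝ := {ξ | |ξ| ≤ bandwidth n ∨ (n + 3) * bandwidth n ≤ |ξ|}
  have hK : IsClosed K := (isClosed_le continuous_abs continuous_const).union
    (isClosed_le continuous_const continuous_abs)
  have hvanish := fourier_eq_zero_of_forall_integral_mul_fourier hF hK.isOpen_compl fun φ hφ => by
    have hlim := tendsto_integral_mul_of_tendsto_Lp hg ((𝓕 φ).memLp 2)
    have hzero : ∀ᶠ m in atTop, ∫ t, (approxLp hf m t : ℂ) * (𝓕 φ) t = 0 := by
      filter_upwards [eventually_ge_atTop n] with m hm
      rw [← (frequencies_approx hf hm).integral_mul_fourier_eq_zero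
        (fun x hx => by simpa only [mem_ofPred_eq, abs_neg] using hx) φ
        (fun x hx => hφ x (fun h => h hx))]
      refine integral_congr_ae ?_
      filter_upwards [(isProfile_approx hf m).memLp_two.coeFn_toLp] with t ht
      rw [approxLp, ht, SchwartzMap.fourier_coe]
    refine Eq.trans (integral_congr_ae ?_)
      (tendsto_nhds_unique hlim (tendsto_const_nhds.congr' (hzero.mono fun _ h => h.symm)))
    filter_upwards [hFg] with t ht
    rw [ht, SchwartzMap.fourier_coe]
  refine closure_minimal (fun ξ hξ => ?_) hK
  by_contra h
  exact hξ (hvanish ξ h)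

/-- There exists a measurable set `S ⊆ ℝ` of finite positive Lebesgue measure such that the
spectrum `Q` of the indicator function `1_S` (the closure of the set of frequencies where the
Fourier transform of `1_S` is nonzero) has density zero: `|Q ∩ (−R, R)| / R → 0` as `R → ∞`. -/
theorem exists_indicator_support_finite_measure_spectrum_density_zero :
    ∃ S : Set ℝ, MeasurableSet S ∧ 0 < volume S ∧ volume S < ⊤ ∧
      Tendsto
        (fun R : ℝ =>
          (volume (closure {ξ : ℝ | 𝓕 (S.indicator (fun _ => (1 : ℂ))) ξ ≠ 0} ∩ Ioo (-R) R)).toReal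
            / R)
        atTop (nhds 0) := by
  obtain ⟨f, hf, hf0⟩ := exists_isProfile
  obtain ⟨S, g, hS, hg, hgS⟩ := exists_tendsto_approxLp_indicator hf
  have hSfin : volume S < ⊤ := by
    have h := ((memLp_congr_ae hgS).1 (Lp.memLp g)).meas_ge_lt_top two_ne_zero
      ENNReal.ofNat_ne_top (one_ne_zero (α := NNReal))
    exact (measure_mono fun t ht => by simp [ht]).trans_lt h
  have hSpos : 0 < volume S := by
    rw [pos_iff_ne_zero]
    intro hS0
    have hg0 : g = 0 := by
      refine Lp.ext (hgS.trans ?_)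
      filter_upwards [Lp.coeFn_zero ℝ 2 (volume : Measure ℝ), measure_eq_zero_iff_ae_notMem.1 hS0]
        with t h1 h2
      rw [h1, indicator_of_notMem h2, Pi.zero_apply]
    have hle : ‖approxLp hf 0‖ ≤ ‖g‖ :=
      (monotone_norm_of_orthogonal_increments (orthogonal_approxLp hf)).ge_of_tendsto hg.norm 0
    rw [hg0, norm_zero, norm_le_zero_iff, Lp.eq_zero_iff_ae_eq_zero] at hle
    have hf_zero : f =ᵐ[volume] 0 := (MemLp.coeFn_toLp hf.memLp_two).symm.trans hle
    have := congrFun ((Continuous.ae_eq_iff_eq volume hf.continuous continuous_zero).1 hf_zero) 0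
    simp [hf0] at this
  have hint : Integrable (S.indicator fun _ => (1 : ℂ)) :=
    (integrable_indicator_iff hS).2 (integrableOn_const hSfin.ne)
  refine ⟨S, hS, hSpos, hSfin,
    tendsto_volume_inter_Ioo_div (closure_spectrum_subset hf hg hint ?_)⟩
  filter_upwards [hgS] with t ht
  rw [ht]
  by_cases h : t ∈ S <;> simp [h]
end

section
/- For every function φ : (0, ∞) → (0, ∞) with φ(R) → ∞ as R → ∞, there exists a measurable set S ⊆ ℝ with finite positive Lebesgue measure such that the spectrum Q of the indicator function 1_S satisfies |Q ∩ (−R, R)| ≤ φ(R) for all sufficiently large R; that is, the measure function h(R) := |Q ∩ (−R, R)| may increase arbitrarily slowly. -/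
open MeasureTheory Filter Real Set
open scoped FourierTransform
open scoped Topology ContDiff

/-- A continuous integrable function whose Fourier transform vanishes outside `[-B, B]`. -/
structure IsBandlimited (B : ℝ) (f : ℝ → ℂ) : Prop where
  continuous : Continuous f
  integrable : Integrable f
  fourier_eq_zero : ∀ ξ, B < |ξ| → 𝓕 f ξ = 0

theorem continuous_fourier_of_integrable {f : ℝ → ℂ} (hf : Integrable f) : Continuous (𝓕 f) :=
  VectorFourier.fourierIntegral_continuous Real.continuous_fourierChar
    continuous_inner hf

theorem integrable_fourierChar_smul {f : ℝ → ℂ} (hf : Integrable f) (ξ : ℝ) :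
    Integrable fun t => 𝐞 (-(t * ξ)) • f t := by
  simpa [mul_comm] using (Real.fourierIntegral_convergent_iff ξ).2 hf

theorem fourier_add_apply {f g : ℝ → ℂ} (hf : Integrable f) (hg : Integrable g) (ξ : ℝ) :
    𝓕 (fun t => f t + g t) ξ = 𝓕 f ξ + 𝓕 g ξ := by
  simp only [Real.fourier_real_eq, smul_add]
  exact integral_add (integrable_fourierChar_smul hf ξ) (integrable_fourierChar_smul hg ξ)

theorem fourier_const_mul_apply (c : ℂ) (f : ℝ → ℂ) (ξ : ℝ) :
    𝓕 (fun t => c * f t) ξ = c * 𝓕 f ξ := by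
  simp only [Real.fourier_real_eq, ← integral_const_mul, Circle.smul_def, smul_eq_mul]
  congr 1 with t
  ring

theorem fourier_conj_apply (f : ℝ → ℂ) (ξ : ℝ) :
    𝓕 (fun t => starRingEnd ℂ (f t)) ξ = starRingEnd ℂ (𝓕 f (-ξ)) := by
  simp only [Real.fourier_real_eq, ← integral_conj, Circle.smul_def, smul_eq_mul, map_mul,
    ← Circle.coe_inv_eq_conj, ← AddChar.map_neg_eq_inv]
  simp

theorem fourier_mul_cos_apply {f : ℝ → ℂ} (hf : Integrable f) (N ξ : ℝ) :
    𝓕 (fun t => f t * (Real.cos (2 * π * N * t) : ℂ)) ξ = (𝓕 f (ξ - N) + 𝓕 f (ξ + N)) / 2 := by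
  simp only [Real.fourier_real_eq]
  rw [← integral_add (integrable_fourierChar_smul hf (ξ - N))
    (integrable_fourierChar_smul hf (ξ + N)), ← integral_div]
  congr 1 with t
  simp only [Circle.smul_def, smul_eq_mul, Real.fourierChar_apply, Complex.ofReal_cos,
    Complex.cos]
  have h1 : Complex.exp (↑(2 * π * -(t * (ξ - N))) * Complex.I)
      = Complex.exp (↑(2 * π * -(t * ξ)) * Complex.I)
        * Complex.exp (↑(2 * π * N * t) * Complex.I) := by
    rw [← Complex.exp_add]; congr 1; push_cast; ring
  have h2 : Complex.exp (↑(2 * π * -(t * (ξ + N))) * Complex.I)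
      = Complex.exp (↑(2 * π * -(t * ξ)) * Complex.I)
        * Complex.exp (-↑(2 * π * N * t) * Complex.I) := by
    rw [← Complex.exp_add]; congr 1; push_cast; ring
  rw [h1, h2]
  ring

namespace IsBandlimited

variable {B C : ℝ} {f g : ℝ → ℂ}

theorem mono (hf : IsBandlimited B f) (h : B ≤ C) : IsBandlimited C f :=
  ⟨hf.continuous, hf.integrable, fun ξ hξ => hf.fourier_eq_zero ξ (h.trans_lt hξ)⟩

theorem integrable_fourier (hf : IsBandlimited B f) : Integrable (𝓕 f) := by
  refine (continuous_fourier_of_integrable hf.integrable).integrable_of_hasCompactSupport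
    (HasCompactSupport.intro (isCompact_Icc (a := -B) (b := B)) fun ξ hξ =>
      hf.fourier_eq_zero ξ ?_)
  by_contra! h
  exact hξ (abs_le.1 h)

theorem fourierInv_fourier (hf : IsBandlimited B f) : 𝓕⁻ (𝓕 f) = f :=
  hf.continuous.fourierInv_fourier_eq hf.integrable hf.integrable_fourier

theorem exists_norm_le (hf : IsBandlimited B f) : ∃ c, ∀ t, ‖f t‖ ≤ c := by
  refine ⟨∫ ξ, ‖𝓕 f ξ‖, fun t => ?_⟩
  rw [← congrFun hf.fourierInv_fourier t]
  exact VectorFourier.norm_fourierIntegral_le_integral_norm _ _ _ _ _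

theorem fourier_mul_apply (hf : IsBandlimited B f) (hg : Integrable g) (ξ : ℝ) :
    𝓕 (fun t => f t * g t) ξ = ∫ η, 𝓕 f η * 𝓕 g (ξ - η) := by
  have key := VectorFourier.integral_fourierIntegral_smul_eq_flip (μ := volume) (ν := volume)
    (L := -innerₗ ℝ) Real.continuous_fourierChar
    (by simp only [LinearMap.neg_apply, innerₗ_apply_apply]; fun_prop) hf.integrable_fourier
    (integrable_fourierChar_smul hg ξ)
  calc 𝓕 (fun t => f t * g t) ξ = ∫ t, f t * (𝐞 (-(t * ξ)) • g t) := by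
        rw [Real.fourier_real_eq]
        congr 1 with t
        simp only [Circle.smul_def, smul_eq_mul]
        ring
    _ = ∫ t, 𝓕⁻ (𝓕 f) t * (𝐞 (-(t * ξ)) • g t) := by rw [hf.fourierInv_fourier]
    _ = _ := key
    _ = _ := by
        congr 1 with η
        rw [smul_eq_mul, Real.fourier_real_eq]
        congr 1
        refine integral_congr_ae (.of_forall fun t => ?_)
        simp only [smul_smul, ← AddChar.map_add_eq_mul]
        congr 2
        simp
        ring

theorem mul (hf : IsBandlimited B f) (hg : IsBandlimited C g) :
    IsBandlimited (B + C) fun t => f t * g t := by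
  refine ⟨hf.continuous.mul hg.continuous, ?_, fun ξ hξ => ?_⟩
  · obtain ⟨c, hc⟩ := hf.exists_norm_le
    exact hg.integrable.bdd_mul hf.continuous.aestronglyMeasurable (.of_forall hc)
  · rw [hf.fourier_mul_apply hg.integrable]
    refine integral_eq_zero_of_ae (.of_forall fun η => ?_)
    by_cases h : B < |η|
    · simp [hf.fourier_eq_zero η h]
    · have : C < |ξ - η| := by linarith [abs_sub_abs_le_abs_sub ξ η]
      simp [hg.fourier_eq_zero _ this]

theorem add (hf : IsBandlimited B f) (hg : IsBandlimited B g) :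
    IsBandlimited B fun t => f t + g t :=
  ⟨hf.continuous.add hg.continuous, hf.integrable.add hg.integrable, fun ξ hξ => by
    rw [fourier_add_apply hf.integrable hg.integrable, hf.fourier_eq_zero ξ hξ,
      hg.fourier_eq_zero ξ hξ, add_zero]⟩

theorem const_mul (hf : IsBandlimited B f) (c : ℂ) : IsBandlimited B fun t => c * f t :=
  ⟨continuous_const.mul hf.continuous, hf.integrable.const_mul c, fun ξ hξ => by
    rw [fourier_const_mul_apply, hf.fourier_eq_zero ξ hξ, mul_zero]⟩

theorem sub (hf : IsBandlimited B f) (hg : IsBandlimited B g) :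
    IsBandlimited B fun t => f t - g t := by
  simpa [sub_eq_add_neg] using hf.add (hg.const_mul (-1))

theorem conj (hf : IsBandlimited B f) : IsBandlimited B fun t => starRingEnd ℂ (f t) :=
  ⟨Complex.continuous_conj.comp hf.continuous,
    Complex.conjCLE.toContinuousLinearMap.integrable_comp hf.integrable, fun ξ hξ => by
    rw [fourier_conj_apply, hf.fourier_eq_zero (-ξ) (by rwa [abs_neg]), map_zero]⟩

theorem mul_cos (hf : IsBandlimited B f) {N : ℝ} (hN : 0 ≤ N) :
    IsBandlimited (N + B) fun t => f t * (Real.cos (2 * π * N * t) : ℂ) := by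
  refine ⟨hf.continuous.mul (by fun_prop), ?_, fun ξ hξ => ?_⟩
  · refine hf.integrable.mul_bdd (c := 1) (by fun_prop) (.of_forall fun t => ?_)
    rw [Complex.norm_real]
    exact Real.abs_cos_le_one _
  · rw [fourier_mul_cos_apply hf.integrable, hf.fourier_eq_zero, hf.fourier_eq_zero]
    · simp
    · have := abs_sub_abs_le_abs_sub ξ (-N)
      rw [abs_neg, sub_neg_eq_add, abs_of_nonneg hN] at this
      linarith
    · linarith [abs_sub_abs_le_abs_sub ξ N, abs_of_nonneg hN]

/-- A real bandlimited function has no correlation with a cosine of frequency outside the band. -/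
theorem integral_mul_cos {f : ℝ → ℝ} (hf : IsBandlimited B fun t => (f t : ℂ)) {N : ℝ}
    (hN : B < N) : ∫ t, f t * Real.cos (2 * π * N * t) = 0 := by
  have h := fourier_mul_cos_apply hf.integrable N 0
  have hN' : B < |N| := hN.trans_le (le_abs_self N)
  rw [hf.fourier_eq_zero _ (by simpa using hN'), hf.fourier_eq_zero _ (by simpa using hN'),
    Real.fourier_real_eq] at h
  simp only [mul_zero, neg_zero, AddChar.map_zero_eq_one, one_smul, add_zero, zero_div,
    ← Complex.ofReal_mul] at h
  exact Complex.ofReal_eq_zero.1 (integral_complex_ofReal.symm.trans h)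

/-- There is a nonzero bandlimited function with values in `[0, 1]`: the normalized square modulus of
the inverse Fourier transform of a bump function. -/
theorem exists_nonneg : ∃ (B : ℝ) (f : ℝ → ℝ), 0 < B ∧ (∀ t, f t ∈ Icc (0 : ℝ) 1) ∧ f 0 ≠ 0 ∧
    IsBandlimited B fun t => (f t : ℂ) := by
  let χ : ContDiffBump (0 : ℝ) := ⟨1, 2, one_pos, one_lt_two⟩
  have hs : HasCompactSupport fun t => (χ t : ℂ) := χ.hasCompactSupport.comp_left Complex.ofReal_zero
  have hd : ContDiff ℝ ∞ fun t => (χ t : ℂ) := Complex.ofRealCLM.contDiff.comp χ.contDiff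
  let u := hs.toSchwartzMap hd
  have hg : IsBandlimited 2 (𝓕⁻ u : SchwartzMap ℝ ℂ) := by
    refine ⟨SchwartzMap.continuous _, SchwartzMap.integrable _, fun ξ hξ => ?_⟩
    rw [← SchwartzMap.fourier_coe, FourierTransform.fourier_fourierInv_eq]
    simpa [u] using χ.zero_of_le_dist (x := ξ) (by simpa [Real.dist_eq] using hξ.le)
  have hg0 : (𝓕⁻ u : SchwartzMap ℝ ℂ) 0 ≠ 0 := by
    rw [SchwartzMap.fourierInv_coe, Real.fourierInv_eq]
    simp only [inner_zero_right, AddChar.map_zero_eq_one, one_smul]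
    change ∫ t, (χ t : ℂ) ≠ 0
    rw [integral_complex_ofReal]
    exact_mod_cast χ.integral_pos.ne'
  generalize (𝓕⁻ u : SchwartzMap ℝ ℂ) = g at hg hg0
  obtain ⟨c, hc⟩ := hg.exists_norm_le
  have hc0 : 0 < c := (norm_pos_iff.2 hg0).trans_le (hc 0)
  refine ⟨2 + 2, fun t => (‖g t‖ / c) ^ 2, by norm_num, fun t => ⟨by positivity, ?_⟩, ?_, ?_⟩
  · exact pow_le_one₀ (by positivity) ((div_le_one hc0).2 (hc t))
  · have := norm_pos_iff.2 hg0
    positivity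
  · convert (hg.mul hg.conj).const_mul ((c : ℂ) ^ 2)⁻¹ using 2 with t
    rw [Complex.mul_conj, Complex.normSq_eq_norm_sq]
    push_cast
    field_simp

end IsBandlimited

/-- Frequencies `N n` and bandwidths `B n`, and functions `f n` with values in `[0, 1]` obtained by
adding to `f n` a multiple of `f n * (1 - f n)` oscillating much faster than the band of `f n`. -/
structure IsOscillationScheme (N B : ℕ → ℝ) (f : ℕ → ℝ → ℝ) : Prop where
  band_zero_pos : 0 < B 0
  band_succ : ∀ n, B (n + 1) = N n + 2 * B n
  lt_freq : ∀ n, 3 * B n < N n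
  zero_mem : ∀ t, f 0 t ∈ Icc (0 : ℝ) 1
  bandlimited_zero : IsBandlimited (B 0) fun t => (f 0 t : ℂ)
  succ : ∀ n t, f (n + 1) t = f n t + f n t * (1 - f n t) * Real.cos (2 * π * N n * t)

namespace IsOscillationScheme

variable {N B : ℕ → ℝ} {f : ℕ → ℝ → ℝ}

theorem band_pos (h : IsOscillationScheme N B f) (n : ℕ) : 0 < B n := by
  induction n with
  | zero => exact h.band_zero_pos
  | succ n ih => linarith [h.band_succ n, h.lt_freq n]

theorem freq_nonneg (h : IsOscillationScheme N B f) (n : ℕ) : 0 ≤ N n := by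
  linarith [h.band_pos n, h.lt_freq n]

theorem band_monotone (h : IsOscillationScheme N B f) : Monotone B :=
  monotone_nat_of_le_succ fun n => by linarith [h.band_succ n, h.lt_freq n, h.band_pos n]

theorem apply_mem_Icc (h : IsOscillationScheme N B f) (n : ℕ) (t : ℝ) : f n t ∈ Icc (0 : ℝ) 1 := by
  induction n with
  | zero => exact h.zero_mem t
  | succ n ih =>
    obtain ⟨h0, h1⟩ := ih
    have hv : 0 ≤ f n t * (1 - f n t) := mul_nonneg h0 (sub_nonneg.2 h1)
    have hc := Real.neg_one_le_cos (2 * π * N n * t)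
    have hc' := Real.cos_le_one (2 * π * N n * t)
    rw [h.succ]
    constructor <;> nlinarith

theorem bandlimited_mul_one_sub_of_bandlimited {b : ℝ} {g : ℝ → ℝ} (hb : 0 ≤ b)
    (hg : IsBandlimited b fun t => (g t : ℂ)) :
    IsBandlimited (2 * b) fun t => ((g t * (1 - g t) : ℝ) : ℂ) := by
  convert (hg.mono (by linarith : b ≤ 2 * b)).sub ((hg.mul hg).mono (two_mul b).ge) using 2 with t
  push_cast
  ring

theorem bandlimited (h : IsOscillationScheme N B f) (n : ℕ) :
    IsBandlimited (B n) fun t => (f n t : ℂ) := by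
  induction n with
  | zero => exact h.bandlimited_zero
  | succ n ih =>
    have hv := (bandlimited_mul_one_sub_of_bandlimited (h.band_pos n).le ih).mul_cos
      (h.freq_nonneg n)
    rw [← h.band_succ] at hv
    convert (ih.mono (h.band_monotone n.le_succ)).add hv using 2 with t
    rw [h.succ]
    push_cast
    ring

theorem bandlimited_mul_one_sub (h : IsOscillationScheme N B f) (n : ℕ) :
    IsBandlimited (2 * B n) fun t => ((f n t * (1 - f n t) : ℝ) : ℂ) :=
  bandlimited_mul_one_sub_of_bandlimited (h.band_pos n).le (h.bandlimited n)

theorem continuous (h : IsOscillationScheme N B f) (n : ℕ) : Continuous (f n) := 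
  Complex.continuous_re.comp (h.bandlimited n).continuous

theorem integrable (h : IsOscillationScheme N B f) (n : ℕ) : Integrable (f n) := by
  simpa using (h.bandlimited n).integrable.re

theorem integrable_mul_of_abs_le_one (h : IsOscillationScheme N B f) (n : ℕ) {g : ℝ → ℝ}
    (hg : Continuous g) (hg1 : ∀ t, |g t| ≤ 1) : Integrable fun t => f n t * g t :=
  (h.integrable n).mul_bdd hg.aestronglyMeasurable (.of_forall hg1)

theorem abs_le_one (h : IsOscillationScheme N B f) (n : ℕ) (t : ℝ) : |f n t| ≤ 1 :=
  abs_le.2 ⟨by linarith [(h.apply_mem_Icc n t).1], (h.apply_mem_Icc n t).2⟩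

theorem integrable_mul (h : IsOscillationScheme N B f) (m n : ℕ) :
    Integrable fun t => f m t * f n t :=
  h.integrable_mul_of_abs_le_one m (h.continuous n) (h.abs_le_one n)

theorem integrable_mul_one_sub_sq (h : IsOscillationScheme N B f) (n : ℕ) :
    Integrable fun t => (f n t * (1 - f n t)) ^ 2 := by
  have hc := h.continuous n
  convert h.integrable_mul_of_abs_le_one n (g := fun t => f n t * (1 - f n t) ^ 2) (by fun_prop)
    (fun t => ?_) using 2 with t
  · ring
  · obtain ⟨h0, h1⟩ := h.apply_mem_Icc n t
    have := sub_nonneg.2 h1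
    rw [abs_of_nonneg (by positivity)]
    exact mul_le_one₀ h1 (by positivity) (pow_le_one₀ this (by linarith))

theorem integral_eq (h : IsOscillationScheme N B f) (n : ℕ) : ∫ t, f n t = ∫ t, f 0 t := by
  induction n with
  | zero => rfl
  | succ n ih =>
    have hv := (h.bandlimited_mul_one_sub n).integral_mul_cos (N := N n)
      (by linarith [h.lt_freq n, h.band_pos n])
    have hd : ∀ t, f n t * (1 - f n t) * Real.cos (2 * π * N n * t) = f (n + 1) t - f n t :=
      fun t => by rw [h.succ]; ring
    simp only [hd] at hv
    rw [integral_sub (h.integrable _) (h.integrable _)] at hv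
    linarith

/-- The increments are orthogonal to the earlier functions. -/
theorem integral_mul_eq (h : IsOscillationScheme N B f) {m n : ℕ} (hmn : m ≤ n) :
    ∫ t, f n t * f m t = ∫ t, f m t ^ 2 := by
  induction n, hmn using Nat.le_induction with
  | base => simp only [sq]
  | succ n hmn ih =>
    have hb := ((h.bandlimited m).mono (h.band_monotone hmn)).mul (h.bandlimited_mul_one_sub n)
    simp only [← Complex.ofReal_mul] at hb
    have hv := hb.integral_mul_cos (N := N n) (by linarith [h.lt_freq n])
    have hd : ∀ t, f m t * (f n t * (1 - f n t)) * Real.cos (2 * π * N n * t)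
        = f (n + 1) t * f m t - f n t * f m t := fun t => by rw [h.succ]; ring
    simp only [hd] at hv
    rw [integral_sub (h.integrable_mul _ _) (h.integrable_mul _ _)] at hv
    linarith

theorem integrable_sq (h : IsOscillationScheme N B f) (n : ℕ) : Integrable fun t => f n t ^ 2 := by
  simpa only [sq] using h.integrable_mul n n

theorem memLp_two (h : IsOscillationScheme N B f) (n : ℕ) : MemLp (f n) 2 :=
  (memLp_two_iff_integrable_sq (h.continuous n).aestronglyMeasurable).2 (h.integrable_sq n)

theorem integral_sub_sq (h : IsOscillationScheme N B f) {m n : ℕ} (hmn : m ≤ n) :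
    ∫ t, (f n t - f m t) ^ 2 = (∫ t, f n t ^ 2) - ∫ t, f m t ^ 2 := by
  have e : ∀ t, (f n t - f m t) ^ 2 = f n t ^ 2 - 2 * (f n t * f m t) + f m t ^ 2 :=
    fun t => by ring
  simp only [e]
  have hi : Integrable fun t => f n t ^ 2 - 2 * (f n t * f m t) :=
    (h.integrable_sq n).sub ((h.integrable_mul n m).const_mul 2)
  rw [integral_add hi (h.integrable_sq m),
    integral_sub (h.integrable_sq n) ((h.integrable_mul n m).const_mul 2), integral_const_mul, h.integral_mul_eq hmn]
  ring

theorem integral_sq_succ (h : IsOscillationScheme N B f) (n : ℕ) :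
    ∫ t, (f n t * (1 - f n t)) ^ 2 = 2 * ((∫ t, f (n + 1) t ^ 2) - ∫ t, f n t ^ 2) := by
  have hb := (h.bandlimited_mul_one_sub n).mul (h.bandlimited_mul_one_sub n)
  simp only [← Complex.ofReal_mul] at hb
  have hv := hb.integral_mul_cos (N := 2 * N n) (by linarith [h.lt_freq n, h.band_pos n])
  have hd : ∀ t, f n t * (1 - f n t) * (f n t * (1 - f n t)) * Real.cos (2 * π * (2 * N n) * t)
      = 2 * (f (n + 1) t - f n t) ^ 2 - (f n t * (1 - f n t)) ^ 2 := fun t => by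
    rw [h.succ, show 2 * π * (2 * N n) * t = 2 * (2 * π * N n * t) by ring, Real.cos_two_mul]
    ring
  have hi : Integrable fun t => (f (n + 1) t - f n t) ^ 2 :=
    ((h.memLp_two (n + 1)).sub (h.memLp_two n)).integrable_sq
  simp only [hd] at hv
  rw [integral_sub (hi.const_mul 2) (h.integrable_mul_one_sub_sq n), integral_const_mul,
    h.integral_sub_sq n.le_succ] at hv
  linarith

theorem integral_sq_monotone (h : IsOscillationScheme N B f) :
    Monotone fun n => ∫ t, f n t ^ 2 := fun m n hmn => by
  have := h.integral_sub_sq hmn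
  have : 0 ≤ ∫ t, (f n t - f m t) ^ 2 := integral_nonneg fun t => sq_nonneg _
  simp only
  linarith

theorem integral_sq_le (h : IsOscillationScheme N B f) (n : ℕ) :
    ∫ t, f n t ^ 2 ≤ ∫ t, f 0 t := by
  rw [← h.integral_eq n]
  refine integral_mono (h.integrable_sq n) (h.integrable n) fun t => ?_
  obtain ⟨h0, h1⟩ := h.apply_mem_Icc n t
  simp only
  nlinarith

theorem exists_tendsto_integral_sq (h : IsOscillationScheme N B f) :
    ∃ a, Tendsto (fun n => ∫ t, f n t ^ 2) atTop (𝓝 a) :=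
  ⟨_, tendsto_atTop_ciSup h.integral_sq_monotone ⟨_, forall_mem_range.2 h.integral_sq_le⟩⟩

theorem tendsto_integral_mul_one_sub_sq (h : IsOscillationScheme N B f) :
    Tendsto (fun n => ∫ t, (f n t * (1 - f n t)) ^ 2) atTop (𝓝 0) := by
  obtain ⟨a, ha⟩ := h.exists_tendsto_integral_sq
  simp only [h.integral_sq_succ]
  simpa using (((tendsto_add_atTop_iff_nat 1).2 ha).sub ha).const_mul 2

theorem exists_seq_tendsto_ae (h : IsOscillationScheme N B f) :
    ∃ (ns : ℕ → ℕ) (g : ℝ → ℝ), StrictMono ns ∧ Measurable g ∧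
      ∀ᵐ t, Tendsto (fun k => f (ns k) t) atTop (𝓝 (g t)) := by
  obtain ⟨a, ha⟩ := h.exists_tendsto_integral_sq
  let F : ℕ → Lp ℝ 2 (volume : Measure ℝ) := fun n => (h.memLp_two n).toLp (f n)
  have hnorm : ∀ m n, m ≤ n →
      ‖F n - F m‖ ^ 2 = (∫ t, f n t ^ 2) - ∫ t, f m t ^ 2 := fun m n hmn => by
    rw [← h.integral_sub_sq hmn, ← real_inner_self_eq_norm_sq, L2.inner_def]
    refine integral_congr_ae ?_
    filter_upwards [Lp.coeFn_sub (F n) (F m), (h.memLp_two n).coeFn_toLp,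
      (h.memLp_two m).coeFn_toLp] with t h1 h2 h3
    simp only [h1, Pi.sub_apply, F, h2, h3]
    simp [sq]
  have hF : CauchySeq F := by
    refine Metric.cauchySeq_iff'.2 fun ε hε => ?_
    obtain ⟨m, hm⟩ := Metric.cauchySeq_iff'.1 ha.cauchySeq (ε ^ 2) (by positivity)
    refine ⟨m, fun n hn => ?_⟩
    rw [dist_eq_norm]
    refine lt_of_pow_lt_pow_left₀ 2 hε.le ?_
    rw [hnorm m n hn]
    exact (le_abs_self _).trans_lt (hm n hn)
  obtain ⟨G, hG⟩ := cauchySeq_tendsto_of_complete hF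
  obtain ⟨ns, hns, hlim⟩ := (tendstoInMeasure_of_tendsto_Lp hG).exists_seq_tendsto_ae
  refine ⟨ns, G, hns, (Lp.stronglyMeasurable G).measurable, ?_⟩
  filter_upwards [hlim, ae_all_iff.2 fun n => (h.memLp_two n).coeFn_toLp] with t ht h'
  simpa only [F, h'] using ht

/-- A subsequence converges almost everywhere to an indicator function. -/
theorem exists_seq_tendsto_indicator (h : IsOscillationScheme N B f) :
    ∃ (ns : ℕ → ℕ) (S : Set ℝ), StrictMono ns ∧ MeasurableSet S ∧ volume S < ⊤ ∧
      ∀ᵐ t, Tendsto (fun k => f (ns k) t) atTop (𝓝 (S.indicator (fun _ => (1 : ℝ)) t)) := by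
  obtain ⟨ns, g, hns, hgm, hlim⟩ := h.exists_seq_tendsto_ae
  have hfm : ∀ n, Measurable (f n) := fun n => (h.continuous n).measurable
  have hzero : ∫⁻ t, ENNReal.ofReal ((g t * (1 - g t)) ^ 2) = 0 := by
    have hv : Tendsto (fun k => ∫⁻ t, ENNReal.ofReal ((f (ns k) t * (1 - f (ns k) t)) ^ 2)) atTop
        (𝓝 0) := by
      have := ENNReal.tendsto_ofReal (h.tendsto_integral_mul_one_sub_sq.comp hns.tendsto_atTop)
      simp only [ENNReal.ofReal_zero] at this
      refine this.congr fun k => ?_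
      exact ofReal_integral_eq_lintegral_ofReal (h.integrable_mul_one_sub_sq _)
        (.of_forall fun t => sq_nonneg _)
    rw [← nonpos_iff_eq_zero, ← hv.liminf_eq]
    refine le_trans (lintegral_mono_ae ?_) (lintegral_liminf_le fun k => by fun_prop)
    filter_upwards [hlim] with t ht
    exact (ENNReal.tendsto_ofReal ((ht.mul (ht.const_sub 1)).pow 2)).liminf_eq.ge
  have hfin : ∫⁻ t, ENNReal.ofReal (g t) ≤ ENNReal.ofReal (∫ t, f 0 t) := by
    have hk : ∀ k, ∫⁻ t, ENNReal.ofReal (f (ns k) t) = ENNReal.ofReal (∫ t, f 0 t) := fun k => by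
      rw [← h.integral_eq (ns k), ofReal_integral_eq_lintegral_ofReal (h.integrable _)
        (.of_forall fun t => (h.apply_mem_Icc _ t).1)]
    calc ∫⁻ t, ENNReal.ofReal (g t)
        ≤ ∫⁻ t, liminf (fun k => ENNReal.ofReal (f (ns k) t)) atTop := by
          refine lintegral_mono_ae ?_
          filter_upwards [hlim] with t ht
          exact (ENNReal.tendsto_ofReal ht).liminf_eq.ge
      _ ≤ liminf (fun k => ∫⁻ t, ENNReal.ofReal (f (ns k) t)) atTop :=
          lintegral_liminf_le fun k => by fun_prop
      _ = _ := by simp only [hk, liminf_const]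
  have hS : MeasurableSet {t | g t = 1} := hgm (measurableSet_singleton 1)
  refine ⟨ns, {t | g t = 1}, hns, hS, ?_, ?_⟩
  · calc volume {t | g t = 1} = ∫⁻ t, {t | g t = 1}.indicator 1 t := (lintegral_indicator_one hS).symm
      _ ≤ ∫⁻ t, ENNReal.ofReal (g t) := lintegral_mono fun t => by
          by_cases ht : g t = 1 <;> simp [ht]
      _ ≤ _ := hfin
      _ < ⊤ := ENNReal.ofReal_lt_top
  · rw [lintegral_eq_zero_iff (by fun_prop)] at hzero
    filter_upwards [hlim, hzero] with t ht h0
    convert ht using 2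
    have h1 : g t * (1 - g t) = 0 := by
      have := ENNReal.ofReal_eq_zero.1 h0
      exact pow_eq_zero_iff two_ne_zero |>.1 (le_antisymm this (sq_nonneg _))
    rcases mul_eq_zero.1 h1 with h2 | h2
    · simp [h2]
    · simp [(sub_eq_zero.1 h2).symm]

theorem tendsto_integral_mul {ns : ℕ → ℕ} {S : Set ℝ} (h : IsOscillationScheme N B f)
    (hlim : ∀ᵐ t, Tendsto (fun k => f (ns k) t) atTop (𝓝 (S.indicator (fun _ => (1 : ℝ)) t)))
    {ψ : ℝ → ℂ} (hψ : Integrable ψ) :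
    Tendsto (fun k => ∫ t, (f (ns k) t : ℂ) * ψ t) atTop
      (𝓝 (∫ t, S.indicator (fun _ => (1 : ℂ)) t * ψ t)) := by
  refine tendsto_integral_of_dominated_convergence (fun t => ‖ψ t‖)
    (fun k => (h.bandlimited _).continuous.aestronglyMeasurable.mul hψ.aestronglyMeasurable)
    hψ.norm (fun k => .of_forall fun t => ?_) ?_
  · rw [norm_mul, Complex.norm_real]
    exact mul_le_of_le_one_left (norm_nonneg _) (h.abs_le_one _ t)
  · filter_upwards [hlim] with t ht
    have hc : S.indicator (fun _ => (1 : ℂ)) t = (S.indicator (fun _ => (1 : ℝ)) t : ℝ) := by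
      by_cases hS : t ∈ S <;> simp [hS]
    rw [hc]
    exact ((Complex.continuous_ofReal.tendsto _).comp ht).mul_const _

theorem volume_pos {ns : ℕ → ℕ} {S : Set ℝ} (h : IsOscillationScheme N B f) (h0 : f 0 0 ≠ 0)
    (hlim : ∀ᵐ t, Tendsto (fun k => f (ns k) t) atTop (𝓝 (S.indicator (fun _ => (1 : ℝ)) t))) :
    0 < volume S := by
  refine pos_iff_ne_zero.2 fun hS => ?_
  have ht := h.tendsto_integral_mul hlim (h.bandlimited 0).integrable
  simp only [← Complex.ofReal_mul, integral_complex_ofReal, h.integral_mul_eq (Nat.zero_le _)] at ht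
  have hz : ∫ t, S.indicator (fun _ => (1 : ℂ)) t * (f 0 t : ℂ) = 0 := by
    refine integral_eq_zero_of_ae ?_
    filter_upwards [indicator_meas_zero (f := fun _ => (1 : ℂ)) hS] with t ht
    simp [ht]
  rw [hz] at ht
  have hpos : 0 < ∫ t, f 0 t ^ 2 :=
    integral_pos_of_integrable_nonneg_nonzero ((h.continuous 0).pow 2) (h.integrable_sq 0)
      (fun t => sq_nonneg _) (pow_ne_zero 2 h0)
  exact hpos.ne' (Complex.ofReal_eq_zero.1 (tendsto_nhds_unique tendsto_const_nhds ht))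

/-- If the Fourier transforms of all later functions vanish on an open set, then so does that of the
limiting indicator function. -/
theorem fourier_indicator_eq_zero {ns : ℕ → ℕ} {S : Set ℝ} (h : IsOscillationScheme N B f)
    (hns : StrictMono ns) (hSm : MeasurableSet S) (hS : volume S < ⊤)
    (hlim : ∀ᵐ t, Tendsto (fun k => f (ns k) t) atTop (𝓝 (S.indicator (fun _ => (1 : ℝ)) t)))
    {U : Set ℝ} (hU : IsOpen U) {n : ℕ}
    (hfU : ∀ m, n ≤ m → ∀ ξ ∈ U, 𝓕 (fun t => (f m t : ℂ)) ξ = 0) {ξ : ℝ} (hξ : ξ ∈ U) :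
    𝓕 (S.indicator fun _ => (1 : ℂ)) ξ = 0 := by
  have hint : Integrable (S.indicator fun _ => (1 : ℂ)) :=
    (integrable_indicator_iff hSm).2 (integrableOn_const hS.ne)
  have hcont := continuous_fourier_of_integrable hint
  have hflip : ∀ {u ψ : ℝ → ℂ}, Integrable u → Integrable ψ →
      ∫ ξ, 𝓕 u ξ * ψ ξ = ∫ t, u t * 𝓕 ψ t := fun hu hψ => by
    have := VectorFourier.integral_fourierIntegral_smul_eq_flip (L := innerₗ ℝ)
      Real.continuous_fourierChar continuous_inner hu hψ
    rwa [flip_innerₗ] at this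
  have hae : ∀ᵐ ξ, ξ ∈ U → 𝓕 (S.indicator fun _ => (1 : ℂ)) ξ = 0 := by
    refine hU.ae_eq_zero_of_integral_contDiff_smul_eq_zero
      (hcont.locallyIntegrable.locallyIntegrableOn U) fun ψ hψ hψc hψU => ?_
    have hcs : HasCompactSupport fun t => (ψ t : ℂ) := hψc.comp_left Complex.ofReal_zero
    have hcd : ContDiff ℝ ∞ fun t => (ψ t : ℂ) :=
      Complex.ofRealCLM.contDiff.comp hψ
    have hFψ : Integrable (𝓕 fun t => (ψ t : ℂ)) := by
      simpa [SchwartzMap.fourier_coe] using!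
        (𝓕 (hcs.toSchwartzMap hcd) : SchwartzMap ℝ ℂ).integrable
    have hψi : Integrable fun t => (ψ t : ℂ) := hcd.continuous.integrable_of_hasCompactSupport hcs
    have hconst : ∀ k, n ≤ k → ∫ t, (f (ns k) t : ℂ) * 𝓕 (fun t => (ψ t : ℂ)) t = 0 :=
      fun k hk => by
        rw [← hflip (h.bandlimited _).integrable hψi]
        refine integral_eq_zero_of_ae (.of_forall fun ξ => ?_)
        by_cases hξ : ξ ∈ U
        · simp [hfU (ns k) (hk.trans (hns.id_le k)) ξ hξ]
        · simp [image_eq_zero_of_notMem_tsupport fun hξ' => hξ (hψU hξ')]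
    have ht := h.tendsto_integral_mul hlim hFψ
    have hz := tendsto_nhds_unique ht (tendsto_const_nhds.congr'
      ((eventually_ge_atTop n).mono fun k hk => (hconst k hk).symm))
    rw [← hflip hint hψi] at hz
    simpa only [Complex.real_smul, mul_comm] using hz
  by_contra hne
  have hopen : IsOpen (U ∩ {ξ | 𝓕 (S.indicator fun _ => (1 : ℂ)) ξ ≠ 0}) :=
    hU.inter (isOpen_ne_fun hcont continuous_const)
  refine (hopen.measure_pos volume ⟨ξ, hξ, hne⟩).ne' (measure_mono_null ?_ (ae_iff.1 hae))
  rintro x ⟨hx, hx'⟩ hxx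
  exact hx' (hxx hx)

theorem fourier_succ (h : IsOscillationScheme N B f) (n : ℕ) (ξ : ℝ) :
    𝓕 (fun t => (f (n + 1) t : ℂ)) ξ = 𝓕 (fun t => (f n t : ℂ)) ξ +
      (𝓕 (fun t => ((f n t * (1 - f n t) : ℝ) : ℂ)) (ξ - N n) +
        𝓕 (fun t => ((f n t * (1 - f n t) : ℝ) : ℂ)) (ξ + N n)) / 2 := by
  have hb := h.bandlimited_mul_one_sub n
  rw [← fourier_mul_cos_apply hb.integrable, ← fourier_add_apply (h.bandlimited n).integrable
    (hb.mul_cos (h.freq_nonneg n)).integrable]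
  refine congrArg (fun u : ℝ → ℂ => 𝓕 u ξ) (funext fun t => ?_)
  rw [h.succ]
  push_cast
  ring

theorem fourier_eq_of_abs_lt (h : IsOscillationScheme N B f) {m n : ℕ} (hnm : n ≤ m) {ξ : ℝ}
    (hξ : |ξ| < N n - 2 * B n) :
    𝓕 (fun t => (f m t : ℂ)) ξ = 𝓕 (fun t => (f n t : ℂ)) ξ := by
  induction m, hnm using Nat.le_induction with
  | base => rfl
  | succ m hnm ih =>
    have hm : |ξ| < N m - 2 * B m := by
      rcases hnm.eq_or_lt with rfl | hlt
      · exact hξ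
      · have := h.band_monotone hlt
        linarith [h.band_succ n, h.lt_freq m, h.band_pos n]
    have h1 := abs_lt.1 hm
    rw [h.fourier_succ, ih, (h.bandlimited_mul_one_sub m).fourier_eq_zero,
      (h.bandlimited_mul_one_sub m).fourier_eq_zero]
    · simp
    · exact lt_abs.2 (.inl (by linarith))
    · exact lt_abs.2 (.inr (by linarith))

theorem exists_isClosed_volume_le (h : IsOscillationScheme N B f) {M : ℕ → ℝ}
    (hM0 : M 0 = 2 * B 0) (hM : ∀ n, M (n + 1) = M n + 8 * B n) (n : ℕ) :
    ∃ Q : Set ℝ, IsClosed Q ∧ volume Q ≤ ENNReal.ofReal (M n) ∧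
      ∀ ξ ∉ Q, 𝓕 (fun t => (f n t : ℂ)) ξ = 0 := by
  have hM_nonneg : ∀ n, 0 ≤ M n := fun n => by
    induction n with
    | zero => linarith [h.band_pos 0]
    | succ n ih => linarith [h.band_pos n, hM n]
  induction n with
  | zero =>
    refine ⟨Icc (-B 0) (B 0), isClosed_Icc, ?_, fun ξ hξ => (h.bandlimited 0).fourier_eq_zero ξ ?_⟩
    · rw [Real.volume_Icc, hM0, sub_neg_eq_add, two_mul]
    · by_contra! hc
      exact hξ (abs_le.1 hc)
  | succ n ih =>
    obtain ⟨Q, hQ, hvol, hz⟩ := ih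
    have hb := h.band_pos n
    refine ⟨Q ∪ (Icc (N n - 2 * B n) (N n + 2 * B n) ∪ Icc (-N n - 2 * B n) (-N n + 2 * B n)),
      hQ.union (isClosed_Icc.union isClosed_Icc), ?_, fun ξ hξ => ?_⟩
    · calc _ ≤ volume Q + (volume (Icc (N n - 2 * B n) (N n + 2 * B n))
            + volume (Icc (-N n - 2 * B n) (-N n + 2 * B n))) :=
            (measure_union_le _ _).trans (add_le_add_right (measure_union_le _ _) _)
        _ ≤ ENNReal.ofReal (M n) + (ENNReal.ofReal (4 * B n) + ENNReal.ofReal (4 * B n)) := by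
            rw [Real.volume_Icc, Real.volume_Icc]
            gcongr <;> linarith
        _ = ENNReal.ofReal (M (n + 1)) := by
            rw [← ENNReal.ofReal_add (by positivity) (by positivity),
              ← ENNReal.ofReal_add (hM_nonneg n) (by positivity), hM]
            congr 1
            ring
    · simp only [mem_union, mem_Icc, not_or, not_and_or, not_le] at hξ
      obtain ⟨h1, h2, h3⟩ := hξ
      rw [h.fourier_succ, hz ξ h1, (h.bandlimited_mul_one_sub n).fourier_eq_zero,
        (h.bandlimited_mul_one_sub n).fourier_eq_zero]
      · simp
      · rw [lt_abs]; rcases h3 with h3 | h3 <;> [right; left] <;> linarith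
      · rw [lt_abs]; rcases h2 with h2 | h2 <;> [right; left] <;> linarith

theorem volume_spectrum_inter_le {ns : ℕ → ℕ} {S : Set ℝ} (h : IsOscillationScheme N B f)
    {M : ℕ → ℝ} (hM0 : M 0 = 2 * B 0) (hM : ∀ n, M (n + 1) = M n + 8 * B n)
    (hns : StrictMono ns) (hSm : MeasurableSet S) (hS : volume S < ⊤)
    (hlim : ∀ᵐ t, Tendsto (fun k => f (ns k) t) atTop (𝓝 (S.indicator (fun _ => (1 : ℝ)) t)))
    {n : ℕ} {R : ℝ} (hR : R ≤ N n - 2 * B n) :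
    volume (closure {ξ : ℝ | 𝓕 (S.indicator (fun _ => (1 : ℂ))) ξ ≠ 0} ∩ Ioo (-R) R)
      ≤ ENNReal.ofReal (M n) := by
  obtain ⟨Q, hQ, hvol, hz⟩ := h.exists_isClosed_volume_le hM0 hM n
  refine (measure_mono ?_).trans hvol
  rw [inter_comm, ← hQ.closure_eq]
  refine isOpen_Ioo.inter_closure.trans (closure_mono ?_)
  rintro ξ ⟨hξ, hne⟩
  by_contra hξQ
  refine hne (h.fourier_indicator_eq_zero hns hSm hS hlim (isOpen_Ioo.inter hQ.isOpen_compl)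
    (n := n) (fun m hm η hη => ?_) ⟨hξ, hξQ⟩)
  rw [h.fourier_eq_of_abs_lt hm ((abs_lt.2 hη.1).trans_le hR), hz η hη.2]

end IsOscillationScheme

theorem exists_frequencies {φ : ℝ → ℝ} (hφ : Tendsto φ atTop atTop) {b : ℝ} :
    ∃ N B M : ℕ → ℝ, B 0 = b ∧ M 0 = 2 * b ∧ (∀ n, B (n + 1) = N n + 2 * B n) ∧
      (∀ n, M (n + 1) = M n + 8 * B n) ∧ (∀ n, 3 * B n < N n) ∧
      ∀ n, ∀ R, N n - 2 * B n ≤ R → M (n + 1) ≤ φ R := by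
  have hex : ∀ p : ℝ × ℝ, ∃ x, 3 * p.1 < x ∧ ∀ R, x - 2 * p.1 ≤ R → p.2 + 8 * p.1 ≤ φ R := by
    intro p
    obtain ⟨a, ha⟩ := eventually_atTop.1 (hφ.eventually_ge_atTop (p.2 + 8 * p.1))
    refine ⟨max (3 * p.1 + 1) (a + 2 * p.1), by linarith [le_max_left (3 * p.1 + 1) (a + 2 * p.1)],
      fun R hR => ha R (by linarith [le_max_right (3 * p.1 + 1) (a + 2 * p.1)])⟩
  choose F hF hF' using hex
  let p : ℕ → ℝ × ℝ := fun n => n.rec (b, 2 * b) fun _ q => (F q + 2 * q.1, q.2 + 8 * q.1)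
  exact ⟨fun n => F (p n), fun n => (p n).1, fun n => (p n).2, rfl, rfl, fun _ => rfl,
    fun _ => rfl, fun n => hF (p n), fun n => hF' (p n)⟩

/-- For every function `φ` that is positive on `(0, ∞)` and tends to infinity, there is a
measurable set `S ⊆ ℝ` of finite positive Lebesgue measure such that the spectrum `Q` of the
indicator function `1_S` satisfies `|Q ∩ (−R, R)| ≤ φ(R)` for all sufficiently large `R`:
the measure function `h(R) = |Q ∩ (−R, R)|` may increase arbitrarily slowly. -/
theorem exists_indicator_spectrum_measure_growth_arbitrarily_slow
    (φ : ℝ → ℝ) (hφpos : ∀ R : ℝ, 0 < R → 0 < φ R) (hφ : Tendsto φ atTop atTop) :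
    ∃ S : Set ℝ, MeasurableSet S ∧ 0 < volume S ∧ volume S < ⊤ ∧
      ∀ᶠ R : ℝ in atTop,
        (volume (closure {ξ : ℝ | 𝓕 (S.indicator (fun _ => (1 : ℂ))) ξ ≠ 0} ∩ Ioo (-R) R)).toReal
          ≤ φ R := by
  obtain ⟨b, f₀, hb, hf₀, hf₀0, hbl⟩ := IsBandlimited.exists_nonneg
  obtain ⟨N, B, M, hB0, hM0, hB, hM, hN, hMφ⟩ := exists_frequencies hφ (b := b)
  subst hB0
  let f : ℕ → ℝ → ℝ := fun n => n.rec f₀ fun n g t =>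
    g t + g t * (1 - g t) * Real.cos (2 * π * N n * t)
  have h : IsOscillationScheme N B f := ⟨hb, hB, hN, hf₀, hbl, fun _ _ => rfl⟩
  obtain ⟨ns, S, hns, hSm, hS, hlim⟩ := h.exists_seq_tendsto_indicator
  refine ⟨S, hSm, h.volume_pos hf₀0 hlim, hS, ?_⟩
  have hgrow : ∀ n : ℕ, n * B 0 ≤ N n - 2 * B n := fun n => by
    have hn : n * B 0 ≤ B n := by
      induction n with
      | zero => simpa using hb.le
      | succ n ih =>
        push_cast
        linarith [hB n, hN n, h.band_pos n, h.band_monotone n.zero_le]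
    linarith [hN n]
  filter_upwards [eventually_gt_atTop (N 0 - 2 * B 0)] with R hR
  have hex : ∃ n, R ≤ N n - 2 * B n := by
    obtain ⟨n, hn⟩ := exists_nat_ge (R / B 0)
    exact ⟨n, ((div_le_iff₀ hb).1 hn).trans (hgrow n)⟩
  classical
  obtain ⟨n, hn⟩ : ∃ n, Nat.find hex = n + 1 :=
    Nat.exists_eq_succ_of_ne_zero fun h0 => hR.not_ge ((Nat.find_eq_zero hex).1 h0)
  have hle : R ≤ N (n + 1) - 2 * B (n + 1) := hn ▸ Nat.find_spec hex
  have hlt : N n - 2 * B n < R := not_le.1 (Nat.find_min hex (hn ▸ n.lt_succ_self))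
  have hR0 : 0 < R := by linarith [hN n, h.band_pos n]
  have hvol := h.volume_spectrum_inter_le hM0 hM hns hSm hS hlim hle
  have hφR := hMφ n R hlt.le
  calc _ ≤ (ENNReal.ofReal (φ R)).toReal :=
        ENNReal.toReal_mono ENNReal.ofReal_ne_top (hvol.trans (ENNReal.ofReal_le_ofReal hφR))
    _ = φ R := ENNReal.toReal_ofReal (hφpos R hR0).le
end

section
/- There exists a Schwartz function F₀ : ℝ → ℝ such that 0 ≤ F₀(t) ≤ 1 for all t ∈ ℝ, ∫_ℝ F₀ > 0, and the Fourier transform 𝓕F₀(ξ) = ∫_ℝ F₀(t) e^{−2πitξ} dt is a real-valued function that is strictly positive for ξ ∈ (−1, 1) and vanishes for |ξ| ≥ 1. -/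
open MeasureTheory Real
open scoped FourierTransform SchwartzMap

/-- The Fourier transform of a real-valued even function on `ℝ` is real-valued. -/
theorem fourier_ofReal_im_eq_zero_of_even {f : ℝ → ℝ} (hf : ∀ x, f (-x) = f x) (ξ : ℝ) :
    (𝓕 (fun t => (f t : ℂ)) ξ).im = 0 := by
  rw [← Complex.conj_eq_iff_im, fourier_real_eq_integral_exp_smul, ← integral_conj,
    ← integral_neg_eq_self]
  refine integral_congr_ae (.of_forall fun t => ?_)
  simp [hf, ← Complex.exp_conj, Complex.conj_ofNat]

/-- The convolution of two nonnegative continuous compactly supported functions, both supported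
exactly on the open ball of radius `r`, is positive on the open ball of radius `2 * r`. -/
theorem integral_mul_sub_pos_of_support_eq_ball {f : ℝ → ℝ} {r : ℝ} (hf : Continuous f)
    (hc : HasCompactSupport f) (h0 : ∀ x, 0 ≤ f x) (hs : Function.support f = Metric.ball 0 r)
    {ξ : ℝ} (hξ : |ξ| < 2 * r) : 0 < ∫ t, f t * f (ξ - t) := by
  have hne (x : ℝ) (hx : |x| < r) : f x ≠ 0 := by
    rw [← Function.mem_support, hs]
    simpa using hx
  have h2 : |ξ / 2| < r := by
    rw [abs_div, abs_two]
    linarith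
  have hcont : Continuous fun t => f t * f (ξ - t) := by fun_prop
  refine hcont.integral_pos_of_hasCompactSupport_nonneg_nonzero (x := ξ / 2) hc.mul_right
    (fun t => mul_nonneg (h0 _) (h0 _)) (mul_ne_zero (hne _ h2) ?_)
  rw [sub_half]
  exact hne _ h2

/-- The convolution of two functions supported in the open ball of radius `r` vanishes outside the
open ball of radius `2 * r`. -/
theorem integral_mul_sub_eq_zero_of_support_eq_ball {f : ℝ → ℝ} {r : ℝ}
    (hs : Function.support f = Metric.ball 0 r)
    {ξ : ℝ} (hξ : 2 * r ≤ |ξ|) : ∫ t, f t * f (ξ - t) = 0 := by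
  have hz (x : ℝ) (hx : r ≤ |x|) : f x = 0 := by
    rw [← Function.notMem_support, hs]
    simpa using hx
  refine integral_eq_zero_of_ae (.of_forall fun t => ?_)
  rcases le_or_gt r |t| with h | h
  · simp [hz t h]
  · have : f (ξ - t) = 0 := hz _ (by linarith [abs_sub_abs_le_abs_sub ξ t])
    simp [this]

/-- There is a Schwartz function `F₀ : ℝ → ℝ` with `0 ≤ F₀ ≤ 1`, positive integral, whose
Fourier transform is real-valued, strictly positive on `(−1, 1)`, and vanishes for `|ξ| ≥ 1`. -/
theorem exists_seed_function :
    ∃ F₀ : 𝓢(ℝ, ℝ),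
      (∀ t : ℝ, 0 ≤ F₀ t ∧ F₀ t ≤ 1) ∧
      0 < ∫ t : ℝ, F₀ t ∧
      (∀ ξ : ℝ, (𝓕 (fun t => (F₀ t : ℂ)) ξ).im = 0) ∧
      (∀ ξ : ℝ, |ξ| < 1 → 0 < (𝓕 (fun t => (F₀ t : ℂ)) ξ).re) ∧
      (∀ ξ : ℝ, 1 ≤ |ξ| → 𝓕 (fun t => (F₀ t : ℂ)) ξ = 0) := by
  let b : ContDiffBump (0 : ℝ) := ⟨1 / 4, 1 / 2, by norm_num, by norm_num⟩
  have hbs : Function.support b = Metric.ball 0 (1 / 2) := b.support_eq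
  let g : 𝓢(ℝ, ℂ) := (b.hasCompactSupport.toSchwartzMap b.contDiff).postcompCLM Complex.ofRealCLM
  have hg (t : ℝ) : g t = (b t : ℂ) := rfl
  let ψ : 𝓢(ℝ, ℂ) := SchwartzMap.convolution (ContinuousLinearMap.mul ℂ ℂ) g g
  have hψ (ξ : ℝ) : ψ ξ = ((∫ t, b t * b (ξ - t) : ℝ) : ℂ) := by
    simp only [ψ, SchwartzMap.convolution_apply, convolution_def, ContinuousLinearMap.mul_apply',
      hg, ← integral_complex_ofReal, Complex.ofReal_mul]
  let a (t : ℝ) : ℝ := (𝓕 (fun s => (b s : ℂ)) t).re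
  have ha (t : ℝ) : 𝓕 (fun s => (b s : ℂ)) t = (a t : ℂ) :=
    Complex.ext rfl (by simpa using fourier_ofReal_im_eq_zero_of_even b.neg t)
  have ha1 (t : ℝ) : |a t| ≤ 1 := by
    have hvol : volume.real (Metric.closedBall (0 : ℝ) b.rOut) = 1 := by
      simp [b, measureReal_def, Real.volume_closedBall]
    calc |a t| ≤ ‖𝓕 (fun s => (b s : ℂ)) t‖ := Complex.abs_re_le_norm _
      _ ≤ ∫ s, ‖(b s : ℂ)‖ := VectorFourier.norm_fourierIntegral_le_integral_norm _ _ _ _ _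
      _ = ∫ s, b s := by simp [abs_of_nonneg b.nonneg]
      _ ≤ 1 := hvol ▸ b.integral_le_measure_closedBall volume
  have hF (t : ℝ) : (𝓕⁻ ψ) t = ((a (-t) ^ 2 : ℝ) : ℂ) := by
    rw [SchwartzMap.fourierInv_apply_eq]
    change (𝓕 ψ) (-t) = _
    rw [SchwartzMap.fourier_convolution, SchwartzMap.pairing_apply_apply, SchwartzMap.fourier_coe]
    change 𝓕 (fun s => (b s : ℂ)) (-t) * 𝓕 (fun s => (b s : ℂ)) (-t) = _
    rw [ha]
    push_cast
    ring
  let F₀ : 𝓢(ℝ, ℝ) := (𝓕⁻ ψ).postcompCLM Complex.reCLM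
  have hF₀ (t : ℝ) : F₀ t = a (-t) ^ 2 := by
    change ((𝓕⁻ ψ) t).re = _
    rw [hF, Complex.ofReal_re]
  have hfun : (fun t => (F₀ t : ℂ)) = (𝓕⁻ ψ : 𝓢(ℝ, ℂ)) := by
    ext t
    rw [hF₀, hF]
  have hfour (ξ : ℝ) : 𝓕 (fun t => (F₀ t : ℂ)) ξ = ((∫ t, b t * b (ξ - t) : ℝ) : ℂ) := by
    rw [hfun, ← SchwartzMap.fourier_coe, FourierTransform.fourier_fourierInv_eq, hψ]
  have hpos (ξ : ℝ) (hξ : |ξ| < 1) : 0 < (𝓕 (fun t => (F₀ t : ℂ)) ξ).re := by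
    rw [hfour, Complex.ofReal_re]
    exact integral_mul_sub_pos_of_support_eq_ball b.continuous b.hasCompactSupport b.nonneg' hbs
      (by linarith)
  refine ⟨F₀, fun t => ?_, ?_, fun ξ => ?_, hpos, fun ξ hξ => ?_⟩
  · rw [hF₀]
    exact ⟨sq_nonneg _, (sq_le_one_iff_abs_le_one _).2 (ha1 _)⟩
  · simpa [fourier_real_eq_integral_exp_smul, integral_complex_ofReal] using hpos 0 (by simp)
  · rw [hfour, Complex.ofReal_im]
  · rw [hfour, integral_mul_sub_eq_zero_of_support_eq_ball hbs (by linarith), Complex.ofReal_zero]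
end
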